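/- arXiv:2101.03136 — 4 statements merged into one kernel-verified Lean document; each statement's English description precedes it below -/
import Mathlib

section
/- Let M > 0 be fixed. Then, as τ → 0 within the cone {τ = u+iv : v > 0, |u| ≤ Mv}, one has η(τ) = (q₀^{1/24} / √(−iτ)) · (1 + E(τ)), where there exist constants C, δ > 0 such that |E(τ)| ≤ C|q₀| for all τ in the cone with v < δ. -/
open Real Complex

/-- The Dedekind eta function `η(τ) = q^{1/24} ∏_{n≥1} (1 - q^n)` with `q = e^{2πiτ}`. -/
noncomputable def dedekindEta (τ : ℂ) : ℂ :=
  Complex.exp ((π : ℂ) * Complex.I * τ / 12) *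
    ∏' n : ℕ, (1 - Complex.exp (2 * (π : ℂ) * Complex.I * τ * ((n : ℂ) + 1)))

lemma dedekindEta_eq_eta (τ : ℂ) : dedekindEta τ = ModularForm.eta τ := by
  simp only [dedekindEta, ModularForm.eta, ModularForm.eta_q_eq_cexp, Function.Periodic.qParam]
  congr 2
  · push_cast
    ring
  · ext n
    ring_nf

/-- The principal square roots of `-iτ` and `i` multiply to that of `τ` on the upper half-plane. -/
lemma sqrt_neg_I_mul_mul_sqrt_I {τ : ℂ} (hτ : 0 < τ.im) :
    Complex.sqrt (-Complex.I * τ) * Complex.sqrt Complex.I = Complex.sqrt τ := by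
  have hre : 0 < (-Complex.I * τ).re := by simpa using hτ
  have harg := abs_lt.mp (Complex.abs_arg_lt_pi_div_two_iff.mpr (Or.inl hre))
  have hne : -Complex.I * τ ≠ 0 := fun h ↦ by simp [h] at hre
  have hmul : -Complex.I * τ * Complex.I = τ := by
    linear_combination (-τ) * Complex.I_sq
  have hτ0 : τ ≠ 0 := fun h ↦ by simp [h] at hτ
  have hlog := Complex.log_mul hne Complex.I_ne_zero (by
    rw [Complex.arg_I]
    constructor <;> linarith [Real.pi_pos])
  rw [hmul] at hlog
  rw [sqrt_eq_exp hne, sqrt_eq_exp Complex.I_ne_zero, sqrt_eq_exp hτ0,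
    ← Complex.exp_add, hlog, add_div]

/-- The transformation of the eta function under `τ ↦ -1 / τ`. -/
lemma eta_eq_eta_neg_inv_div_sqrt {τ : ℂ} (hτ : 0 < τ.im) :
    ModularForm.eta τ = ModularForm.eta (-1 / τ) / Complex.sqrt (-Complex.I * τ) := by
  have h := ModularForm.eta_comp_eq_csqrt_I_inv hτ
  have hτ0 : τ ≠ 0 := fun h ↦ by simp [h] at hτ
  have h1 : Complex.sqrt (-Complex.I * τ) ≠ 0 := by simp [Complex.sqrt, hτ0]
  have h2 : Complex.sqrt Complex.I ≠ 0 := by simp [Complex.sqrt]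
  simp only [Function.comp_apply, Pi.smul_apply, Pi.mul_apply, smul_eq_mul,
    ← sqrt_neg_I_mul_mul_sqrt_I hτ] at h
  rw [h, eq_div_iff h1, mul_assoc, inv_mul_eq_div, eq_div_iff h2]
  ring

open Asymptotics Topology in
/-- Near the origin, Euler's product `∏ (1 - q ^ (n + 1))` is `1 + O(q)`. -/
lemma tprod_one_sub_pow_sub_one_isBigO :
    (fun q : ℂ ↦ ∏' n : ℕ, (1 - q ^ (n + 1)) - 1) =O[𝓝 0] fun q ↦ q := by
  have h := (ModularForm.differentiableOn_tprod_one_sub_pow.differentiableAt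
    (Metric.ball_mem_nhds 0 one_pos)).isBigO_sub
  simpa using h

/-- In the cone `|u| ≤ M v`, the imaginary part of `-1 / τ` is at least `1 / ((M ^ 2 + 1) v)`. -/
lemma inv_le_div_normSq_of_abs_le_mul {M u v : ℝ} (hv : 0 < v) (hu : |u| ≤ M * v) :
    1 / ((M ^ 2 + 1) * v) ≤ v / (u ^ 2 + v ^ 2) := by
  have hsq : u ^ 2 ≤ (M * v) ^ 2 :=
    sq_le_sq' (by linarith [neg_abs_le u]) (by linarith [le_abs_self u])
  rw [div_le_div_iff₀ (by positivity) (by positivity)]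
  nlinarith

lemma norm_exp_neg_two_pi_I_div (u v : ℝ) :
    ‖Complex.exp (-2 * (π : ℂ) * Complex.I / ((u : ℂ) + (v : ℂ) * Complex.I))‖ =
      Real.exp (-(2 * π * (v / (u ^ 2 + v ^ 2)))) := by
  rw [Complex.norm_exp]
  congr 1
  simp [Complex.div_re, Complex.normSq_apply]
  ring

/-- As `τ → 0` in a cone, `η(τ) = (q₀^{1/24} / √(-iτ)) (1 + O(q₀))`. -/
theorem eta_asymp (M : ℝ) (hM : 0 < M) :
    ∃ C > (0 : ℝ), ∃ δ > (0 : ℝ), ∀ u v : ℝ, 0 < v → |u| ≤ M * v → v < δ →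
      ∃ E : ℂ,
        dedekindEta ((u : ℂ) + (v : ℂ) * Complex.I) =
          (Complex.exp (-2 * (π : ℂ) * Complex.I / (24 * ((u : ℂ) + (v : ℂ) * Complex.I))) /
            (-Complex.I * ((u : ℂ) + (v : ℂ) * Complex.I)) ^ ((1 : ℂ) / 2)) * (1 + E) ∧
        ‖E‖ ≤ C * ‖Complex.exp (-2 * (π : ℂ) * Complex.I / ((u : ℂ) + (v : ℂ) * Complex.I))‖ := by
  obtain ⟨C, hC, hbound⟩ := tprod_one_sub_pow_sub_one_isBigO.exists_pos
  obtain ⟨r, hr, hball⟩ := Metric.eventually_nhds_iff.mp hbound.bound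
  refine ⟨C, hC, r / (M ^ 2 + 1), by positivity, fun u v hv hu hvδ ↦ ?_⟩
  have him : 0 < ((u : ℂ) + (v : ℂ) * Complex.I).im := by simpa using hv
  have hnorm := norm_exp_neg_two_pi_I_div u v
  set τ : ℂ := (u : ℂ) + (v : ℂ) * Complex.I
  set q₀ : ℂ := Complex.exp (-2 * (π : ℂ) * Complex.I / τ) with hq₀
  refine ⟨∏' n : ℕ, (1 - q₀ ^ (n + 1)) - 1, ?_, hball ?_⟩
  · rw [dedekindEta_eq_eta, eta_eq_eta_neg_inv_div_sqrt him, ModularForm.eta]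
    simp only [ModularForm.eta_q_eq_pow, Function.Periodic.qParam, Complex.sqrt, one_div,
      add_sub_cancel]
    rw [show 2 * (π : ℂ) * Complex.I * (-1 / τ) = -2 * (π : ℂ) * Complex.I / τ by ring, ← hq₀,
      Complex.ofReal_ofNat, div_div, mul_comm τ]
    ring
  · have hinv : 1 / r < 1 / ((M ^ 2 + 1) * v) := by
      rw [lt_div_iff₀ (by positivity)] at hvδ
      exact one_div_lt_one_div_of_lt (by positivity) (by linarith)
    have hcone := inv_le_div_normSq_of_abs_le_mul hv hu
    have hr' : 0 < 1 / r := by positivity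
    have hexp : 1 / r < Real.exp (2 * π * (v / (u ^ 2 + v ^ 2))) := by
      nlinarith [Real.add_one_le_exp (2 * π * (v / (u ^ 2 + v ^ 2))), Real.pi_gt_three]
    rw [dist_zero_right, hnorm, Real.exp_neg]
    exact inv_lt_of_inv_lt₀ hr (by simpa using hexp)
end

section
/- Let α ∈ [0,1) and M > 0 be fixed, and set a₁ := 1 + 2cos(2πα) and a₃ := 1 + 2cos(2πα) + 2cos(4πα). Then, as τ → 0 within the cone {τ = u+iv : v > 0, |u| ≤ Mv}, one has ϑ(ατ; τ) = (−2i sin(πα) q^{−α²/2} q₀^{1/8} / √(−iτ)) · (1 − a₁ q₀ + a₃ q₀³ + E(τ)), where there exist constants C, δ > 0 such that |E(τ)| ≤ C|q₀|⁴ for all τ in the cone with v < δ. -/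
open Real Complex

/-- The Jacobi theta function
`ϑ(z;τ) = ∑_{m ∈ 1/2+ℤ} (-1)^m q^{m²/2} e^{2πimz}` with `(-1)^m := e^{πim}`. -/
noncomputable def jtheta (z τ : ℂ) : ℂ :=
  ∑' n : ℤ, Complex.exp ((π : ℂ) * Complex.I * ((n : ℂ) + 1 / 2)) *
    Complex.exp ((π : ℂ) * Complex.I * τ * ((n : ℂ) + 1 / 2) ^ 2) *
    Complex.exp (2 * (π : ℂ) * Complex.I * ((n : ℂ) + 1 / 2) * z)

theorem jtheta_eq_jacobiTheta₂ (z τ : ℂ) :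
    jtheta z τ = I * cexp (π * I * τ / 4 + π * I * z) *
      jacobiTheta₂ (z + τ / 2 + 1 / 2) τ := by
  rw [jtheta, jacobiTheta₂, ← tsum_mul_left]
  congr 1 with n
  have hI : I * cexp (π * I * τ / 4 + π * I * z) =
      cexp (π / 2 * I + (π * I * τ / 4 + π * I * z)) := by
    rw [Complex.exp_add (π / 2 * I), exp_pi_div_two_mul_I]
  rw [hI, jacobiTheta₂_term, ← Complex.exp_add, ← Complex.exp_add, ← Complex.exp_add]
  congr 1
  ring

theorem jtheta_mul_self_eq_jacobiTheta₂_inv (α τ : ℂ) (hτ : τ ≠ 0) :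
    jtheta (α * τ) τ = cexp (-π * I * τ * α ^ 2) * cexp (-π * I / (4 * τ)) /
      (-I * τ) ^ ((1 : ℂ) / 2) *
      (cexp (-π * I * α) * jacobiTheta₂ (α + 1 / 2 + 1 / (2 * τ)) (-1 / τ)) := by
  have hw : (α * τ + τ / 2 + 1 / 2) / τ = α + 1 / 2 + 1 / (2 * τ) := by
    field_simp
  have he : I * (cexp (π * I * τ / 4 + π * I * (α * τ)) *
      cexp (-π * I * (α * τ + τ / 2 + 1 / 2) ^ 2 / τ)) =
      cexp (-π * I * τ * α ^ 2) * cexp (-π * I / (4 * τ)) * cexp (-π * I * α) := by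
    nth_rewrite 1 [← exp_pi_div_two_mul_I]
    simp only [← Complex.exp_add]
    congr 1
    field_simp
    ring
  rw [jtheta_eq_jacobiTheta₂, jacobiTheta₂_functional_equation, hw]
  linear_combination (1 / (-I * τ) ^ ((1 : ℂ) / 2) *
    jacobiTheta₂ (α + 1 / 2 + 1 / (2 * τ)) (-1 / τ)) * he

theorem hasSum_sin_mul_pow_triangular (α τ : ℂ) (hτ : 0 < τ.im) :
    HasSum (fun k : ℕ ↦ -2 * I * ((-1) ^ k * Complex.sin ((2 * k + 1) * (π * α)) *
        cexp (-2 * π * I / τ) ^ (k * (k + 1) / 2)))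
      (cexp (-π * I * α) * jacobiTheta₂ (α + 1 / 2 + 1 / (2 * τ)) (-1 / τ)) := by
  have hτ0 : τ ≠ 0 := by
    rintro rfl
    simp at hτ
  have him : 0 < (-1 / τ).im := by
    have := (UpperHalfPlane.mk τ hτ).im_inv_neg_coe_pos
    simpa [neg_div, inv_neg] using this
  have h := (hasSum_jacobiTheta₂_term (α + 1 / 2 + 1 / (2 * τ)) him).mul_left (cexp (-π * I * α))
  have h' := ((Equiv.addRight (1 : ℤ)).hasSum_iff.mpr h).nat_add_neg_add_one
  refine (congrArg (HasSum · _) (funext fun k ↦ ?_)).mpr h'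
  obtain ⟨m, hm⟩ : 2 ∣ k * (k + 1) := (Nat.even_mul_succ_self k).two_dvd
  have hm' : (2 * m : ℂ) = k * (k + 1) := by exact_mod_cast hm.symm
  have hs : (-1 : ℂ) ^ k = cexp (k * (π * I)) := by
    rw [Complex.exp_nat_mul, Complex.exp_pi_mul_I]
  have hs' : (-1 : ℂ) ^ k = cexp (-(k * (π * I))) := by
    rw [Complex.exp_neg, ← hs, ← inv_pow]
    norm_num
  have hs'' : (-1 : ℂ) ^ (k + 1) = cexp ((k + 1) * (π * I)) := by
    rw [pow_succ, hs, add_one_mul, Complex.exp_add, Complex.exp_pi_mul_I]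
  have hpow : cexp (-2 * π * I / τ) ^ m = cexp (-(k * (k + 1)) * π * I / τ) := by
    rw [← Complex.exp_nat_mul, ← hm']
    congr 1
    ring
  have hpos : cexp (-π * I * α) *
      jacobiTheta₂_term ((k : ℤ) + 1) (α + 1 / 2 + 1 / (2 * τ)) (-1 / τ) =
      (-1) ^ (k + 1) * cexp ((2 * k + 1) * (π * α) * I) * cexp (-(k * (k + 1)) * π * I / τ) := by
    rw [hs'', jacobiTheta₂_term]
    simp only [← Complex.exp_add]
    congr 1
    push_cast
    field_simp
    ring
  have hneg : cexp (-π * I * α) *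
      jacobiTheta₂_term (-((k : ℤ) + 1) + 1) (α + 1 / 2 + 1 / (2 * τ)) (-1 / τ) =
      (-1) ^ k * cexp (-((2 * k + 1) * (π * α)) * I) * cexp (-(k * (k + 1)) * π * I / τ) := by
    rw [hs', jacobiTheta₂_term]
    simp only [← Complex.exp_add]
    congr 1
    push_cast
    field_simp
    ring
  simp only [Function.comp_apply, Equiv.coe_addRight, hpos, hneg]
  rw [hm, Nat.mul_div_cancel_left _ two_pos, hpow, Complex.sin]
  linear_combination ((-1) ^ k * cexp (-(k * (k + 1)) * π * I / τ) *
    (cexp ((2 * k + 1) * (π * α) * I) - cexp (-((2 * k + 1) * (π * α)) * I))) * I_sq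

theorem norm_tsum_sin_mul_pow_triangular_le (x : ℝ) {q : ℂ} (hq : ‖q‖ ≤ 1 / 2) :
    ‖∑' k : ℕ, (-1) ^ (k + 3) * Complex.sin ((2 * (k + 3 : ℕ) + 1) * x) *
      q ^ ((k + 3) * (k + 3 + 1) / 2)‖ ≤ 2 * ‖q‖ ^ 4 := by
  have hsum : HasSum (fun k : ℕ ↦ ‖q‖ ^ 4 * (1 / 2) ^ k) (‖q‖ ^ 4 * 2) :=
    hasSum_geometric_two.mul_left _
  rw [mul_comm]
  refine tsum_of_norm_bounded hsum fun k ↦ ?_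
  have hsin : ‖Complex.sin ((2 * (k + 3 : ℕ) + 1) * x)‖ ≤ 1 := by
    have : Complex.sin ((2 * (k + 3 : ℕ) + 1) * x) =
        (Real.sin ((2 * (k + 3 : ℕ) + 1) * x) : ℝ) := by push_cast; rfl
    rw [this, norm_real]
    exact Real.abs_sin_le_one _
  have hexp : k + 4 ≤ (k + 3) * (k + 3 + 1) / 2 := by
    rw [Nat.le_div_iff_mul_le two_pos]
    nlinarith
  rw [norm_mul, norm_mul, norm_pow, norm_pow, norm_neg, norm_one, one_pow, one_mul]
  calc _ ≤ 1 * ‖q‖ ^ (k + 4) := by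
        exact mul_le_mul hsin (pow_le_pow_of_le_one (norm_nonneg _) (by linarith) hexp)
          (by positivity) zero_le_one
    _ = ‖q‖ ^ 4 * ‖q‖ ^ k := by ring
    _ ≤ _ := by gcongr

theorem norm_exp_neg_two_pi_I_div_le_half {M u v : ℝ} (hv : 0 < v) (hu : |u| ≤ M * v)
    (hvM : v < 1 / (M ^ 2 + 1)) :
    ‖cexp (-2 * π * I / (u + v * I))‖ ≤ 1 / 2 := by
  have hre : (-2 * π * I / (u + v * I)).re = -(2 * π * v / (u ^ 2 + v ^ 2)) := by
    simp [Complex.div_re, Complex.normSq_apply]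
    ring
  have hu2 : u ^ 2 ≤ (M * v) ^ 2 := sq_le_sq' (by linarith [neg_abs_le u]) ((le_abs_self u).trans hu)
  have hv' : v * (M ^ 2 + 1) < 1 := by rwa [lt_div_iff₀ (by positivity)] at hvM
  have h1 : 1 ≤ 2 * π * v / (u ^ 2 + v ^ 2) := by
    rw [le_div_iff₀ (by positivity)]
    nlinarith [pi_gt_three]
  rw [Complex.norm_exp, hre]
  calc Real.exp (-(2 * π * v / (u ^ 2 + v ^ 2))) ≤ Real.exp (-1) := by gcongr
    _ ≤ 1 / 2 := by
      rw [Real.exp_neg, ← one_div]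
      gcongr
      linarith [Real.add_one_le_exp 1]

theorem sin_three_mul_eq_sin_mul (x : ℝ) :
    Real.sin (3 * x) = Real.sin x * (1 + 2 * Real.cos (2 * x)) := by
  rw [Real.sin_three_mul, Real.cos_two_mul, Real.cos_sq']
  ring

theorem sin_five_mul_eq_sin_mul (x : ℝ) :
    Real.sin (5 * x) = Real.sin x * (1 + 2 * Real.cos (2 * x) + 2 * Real.cos (4 * x)) := by
  rw [show 5 * x = 3 * x + 2 * x by ring, show 4 * x = 2 * (2 * x) by ring, Real.sin_add,
    sin_three_mul_eq_sin_mul, Real.cos_two_mul (2 * x), Real.cos_three_mul, Real.sin_two_mul,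
    Real.cos_two_mul]
  ring

theorem jtheta_mul_self_eq_triangular_series (α : ℝ) {τ : ℂ} (hτ : 0 < τ.im) :
    jtheta (α * τ) τ = cexp (-π * I * τ * α ^ 2) * cexp (-π * I / (4 * τ)) /
      (-I * τ) ^ ((1 : ℂ) / 2) * (-2 * I * (Real.sin (π * α) *
        (1 - (1 + 2 * Real.cos (2 * π * α) : ℝ) * cexp (-2 * π * I / τ) +
          (1 + 2 * Real.cos (2 * π * α) + 2 * Real.cos (4 * π * α) : ℝ) *
            cexp (-2 * π * I / τ) ^ 3) +
        ∑' k : ℕ, (-1) ^ (k + 3) * Complex.sin ((2 * (k + 3 : ℕ) + 1) * (π * α : ℝ)) *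
          cexp (-2 * π * I / τ) ^ ((k + 3) * (k + 3 + 1) / 2))) := by
  have hτ0 : τ ≠ 0 := by
    rintro rfl
    simp at hτ
  have h := hasSum_sin_mul_pow_triangular α τ hτ
  have h2I : (-2 * I : ℂ) ≠ 0 := by simp
  have hsum := (summable_mul_left_iff h2I).mp h.summable
  have h3 := congrArg ((↑) : ℝ → ℂ) (sin_three_mul_eq_sin_mul (π * α))
  have h5 := congrArg ((↑) : ℝ → ℂ) (sin_five_mul_eq_sin_mul (π * α))
  rw [jtheta_mul_self_eq_jacobiTheta₂_inv _ _ hτ0, ← h.tsum_eq, tsum_mul_left,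
    ← hsum.sum_add_tsum_nat_add 3]
  simp only [Finset.sum_range_succ, Finset.sum_range_zero]
  rw [show 2 * π * α = 2 * (π * α) by ring, show 4 * π * α = 4 * (π * α) by ring]
  push_cast at h3 h5 ⊢
  rw [show (2 * 0 + 1 : ℂ) = 1 by norm_num, show (2 * 1 + 1 : ℂ) = 3 by norm_num,
    show (2 * 2 + 1 : ℂ) = 5 by norm_num, one_mul, h3, h5]
  norm_num only
  ring

/-- Higher order expansion: as `τ → 0` in a cone, with
`a₁ = 1 + 2cos(2πα)` and `a₃ = 1 + 2cos(2πα) + 2cos(4πα)`,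
`ϑ(ατ;τ) = (-2i sin(πα) q^{-α²/2} q₀^{1/8} / √(-iτ)) (1 - a₁ q₀ + a₃ q₀³ + O(q₀⁴))`. -/
theorem jtheta_alpha_tau_higher_asymp (α M : ℝ) (hα0 : 0 ≤ α) (hα1 : α < 1) (hM : 0 < M) :
    ∃ C > (0 : ℝ), ∃ δ > (0 : ℝ), ∀ u v : ℝ, 0 < v → |u| ≤ M * v → v < δ →
      ∃ E : ℂ,
        jtheta ((α : ℂ) * ((u : ℂ) + (v : ℂ) * Complex.I)) ((u : ℂ) + (v : ℂ) * Complex.I) =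
          ((-2) * Complex.I * ((Real.sin (π * α) : ℝ) : ℂ) *
            Complex.exp (-(π : ℂ) * Complex.I * ((u : ℂ) + (v : ℂ) * Complex.I) * (α : ℂ) ^ 2) *
            Complex.exp (-(π : ℂ) * Complex.I / (4 * ((u : ℂ) + (v : ℂ) * Complex.I))) /
            (-Complex.I * ((u : ℂ) + (v : ℂ) * Complex.I)) ^ ((1 : ℂ) / 2)) *
          (1 - ((1 + 2 * Real.cos (2 * π * α) : ℝ) : ℂ) *
              Complex.exp (-2 * (π : ℂ) * Complex.I / ((u : ℂ) + (v : ℂ) * Complex.I)) +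
            ((1 + 2 * Real.cos (2 * π * α) + 2 * Real.cos (4 * π * α) : ℝ) : ℂ) *
              Complex.exp (-2 * (π : ℂ) * Complex.I / ((u : ℂ) + (v : ℂ) * Complex.I)) ^ 3 + E) ∧
        ‖E‖ ≤ C * ‖Complex.exp (-2 * (π : ℂ) * Complex.I /
          ((u : ℂ) + (v : ℂ) * Complex.I))‖ ^ 4 := by
  have hsin0 : 0 ≤ Real.sin (π * α) :=
    Real.sin_nonneg_of_nonneg_of_le_pi (by positivity) (by nlinarith [pi_pos])
  refine ⟨2 / Real.sin (π * α) + 1, by positivity, 1 / (M ^ 2 + 1), by positivity,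
    fun u v hv hu hvM ↦ ?_⟩
  have hq := norm_exp_neg_two_pi_I_div_le_half hv hu hvM
  have hτ : 0 < ((u : ℂ) + v * I).im := by simpa using hv
  rw [jtheta_mul_self_eq_triangular_series α hτ]
  have hE := norm_tsum_sin_mul_pow_triangular_le (π * α) hq
  set R := ∑' k : ℕ, (-1) ^ (k + 3) * Complex.sin ((2 * (k + 3 : ℕ) + 1) * (π * α : ℝ)) *
    cexp (-2 * π * I / (u + v * I)) ^ ((k + 3) * (k + 3 + 1) / 2) with hR
  refine ⟨R / Real.sin (π * α), ?_, ?_⟩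
  · have hdiv : (Real.sin (π * α) : ℂ) * (R / Real.sin (π * α)) = R := by
      rcases hα0.eq_or_lt with rfl | hα
      · simp [hR]
      · refine mul_div_cancel₀ _ (ofReal_ne_zero.mpr (Real.sin_pos_of_pos_of_lt_pi ?_ ?_).ne')
        · positivity
        · nlinarith [pi_pos]
    nth_rewrite 1 [← hdiv]
    ring
  · rw [norm_div, norm_real, Real.norm_of_nonneg hsin0]
    calc ‖R‖ / Real.sin (π * α) ≤ 2 * ‖cexp (-2 * π * I / (u + v * I))‖ ^ 4 / Real.sin (π * α) := by
          gcongr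
      _ = 2 / Real.sin (π * α) * ‖cexp (-2 * π * I / (u + v * I))‖ ^ 4 := by ring
      _ ≤ _ := by
          gcongr
          linarith
end

section
/- Fix M > 0, δ > 0, and a positive integer b. Write τ = u + iv with v := 1/(δ√n) and suppose |u| > Mv, and set ε := 1 − 1/√(1+M²) > 0. Then, as n → ∞, uniformly in such τ, 1/|ϑ(1/2; bτ)| ≪ n^{−3/4} e^{(δ√n/(πb))(π²/6 − ε)}; i.e., there exist constants C, N such that for all n ≥ N and all such τ, 1/|ϑ(1/2; bτ)| ≤ C n^{−3/4} e^{(δ√n/(πb))(π²/6 − ε)}. -/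
open Real Complex

/-- The partial products of Gauss's product for the generating series of triangular numbers. -/
noncomputable def gaussProd (q : ℂ) (n : ℕ) : ℂ :=
  ∏ k ∈ Finset.range n, (1 - q ^ (2 * k + 2)) / (1 - q ^ (2 * k + 1))

lemma one_sub_pow_ne_zero_of_norm_lt_one {q : ℂ} (hq : ‖q‖ < 1) {k : ℕ} (hk : k ≠ 0) :
    1 - q ^ k ≠ 0 := by
  intro h
  have h1 : ‖q ^ k‖ = 1 := by rw [← sub_eq_zero.mp h, norm_one]
  rw [norm_pow] at h1
  exact absurd h1 (pow_lt_one₀ (norm_nonneg q) hq hk).ne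

lemma gaussProd_succ (q : ℂ) (n : ℕ) :
    gaussProd q (n + 1) = gaussProd q n * ((1 - q ^ (2 * n + 2)) / (1 - q ^ (2 * n + 1))) :=
  Finset.prod_range_succ _ _

lemma gaussProd_ne_zero {q : ℂ} (hq : ‖q‖ < 1) (n : ℕ) : gaussProd q n ≠ 0 :=
  Finset.prod_ne_zero_iff.mpr fun k _ ↦ div_ne_zero
    (one_sub_pow_ne_zero_of_norm_lt_one hq (by omega))
    (one_sub_pow_ne_zero_of_norm_lt_one hq (by omega))

/-- The telescoping identity behind `sum_pow_triangular_eq`. -/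
lemma sum_gaussProd_telescope {q : ℂ} (hq : ‖q‖ < 1) (n m : ℕ) :
    ∑ s ∈ Finset.range m, (gaussProd q (n + 1) / gaussProd q s * q ^ (s * (2 * n + 3))
      - gaussProd q n / gaussProd q s * q ^ (s * (2 * n + 1))) =
    gaussProd q n / gaussProd q m * q ^ (m * (2 * n + 1)) * (1 - q ^ (2 * m))
      / (1 - q ^ (2 * n + 1)) := by
  have hn := one_sub_pow_ne_zero_of_norm_lt_one hq (k := 2 * n + 1) (by omega)
  induction m with
  | zero => simp
  | succ m ih =>
    rw [Finset.sum_range_succ, ih, gaussProd_succ q n, gaussProd_succ q m]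
    have h1 := one_sub_pow_ne_zero_of_norm_lt_one hq (k := 2 * m + 1) (by omega)
    have h2 := one_sub_pow_ne_zero_of_norm_lt_one hq (k := 2 * m + 2) (by omega)
    have h3 := gaussProd_ne_zero hq m
    have e1 : q ^ (m * (2 * n + 3)) = q ^ (m * (2 * n + 1)) * q ^ (2 * m) := by ring
    have e2 : q ^ ((m + 1) * (2 * n + 1)) = q ^ (m * (2 * n + 1)) * q ^ (2 * n + 1) := by ring
    have e3 : q ^ (2 * (m + 1)) = q ^ (2 * m + 2) := by ring
    rw [e1, e2, e3]
    field_simp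
    ring

/-- Shanks's finite form of Gauss's identity for triangular numbers. -/
lemma sum_pow_triangular_eq {q : ℂ} (hq : ‖q‖ < 1) (n : ℕ) :
    ∑ s ∈ Finset.range (2 * n), q ^ (s * (s + 1) / 2) =
      ∑ s ∈ Finset.range n, gaussProd q n / gaussProd q s * q ^ (s * (2 * n + 1)) := by
  induction n with
  | zero => simp
  | succ n ih =>
    have hn := one_sub_pow_ne_zero_of_norm_lt_one hq (k := 2 * n + 1) (by omega)
    have h3 := gaussProd_ne_zero hq n
    have hT := sum_gaussProd_telescope hq n n
    rw [Finset.sum_sub_distrib, ← ih] at hT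
    have e1 : 2 * n * (2 * n + 1) / 2 = n * (2 * n + 1) := by
      rw [mul_assoc]; exact Nat.mul_div_cancel_left _ two_pos
    have e2 : (2 * n + 1) * (2 * n + 1 + 1) / 2 = n * (2 * n + 1) + (2 * n + 1) := by
      rw [show (2 * n + 1) * (2 * n + 1 + 1) = 2 * (n * (2 * n + 1) + (2 * n + 1)) by ring]
      exact Nat.mul_div_cancel_left _ two_pos
    rw [show 2 * (n + 1) = 2 * n + 1 + 1 by ring, Finset.sum_range_succ, Finset.sum_range_succ,
      Finset.sum_range_succ, e1, e2, show 2 * n + 1 + 1 + 1 = 2 * n + 3 by ring,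
      sub_eq_iff_eq_add.mp hT, gaussProd_succ]
    field_simp
    ring

/-- The `m`-th term of the series bounding the logarithm of Gauss's product. -/
noncomputable def gaussLogTerm (q : ℂ) (m : ℕ) : ℝ := ‖q‖ ^ m / (m * ‖1 + q ^ m‖)

lemma gaussLogTerm_nonneg (q : ℂ) (m : ℕ) : 0 ≤ gaussLogTerm q m := by
  unfold gaussLogTerm; positivity

lemma one_sub_norm_pow_le (q : ℂ) (m : ℕ) : 1 - ‖q‖ ^ m ≤ ‖1 + q ^ m‖ := by
  have := norm_sub_norm_le (1 : ℂ) (-q ^ m)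
  simpa using this

lemma gaussLogTerm_le {q : ℂ} {h : ℝ} (hh : 0 < h) (hq : ‖q‖ = Real.exp (-h)) (m : ℕ) :
    gaussLogTerm q m ≤ 1 / h * (1 / (m : ℝ) ^ 2) := by
  rcases Nat.eq_zero_or_pos m with rfl | hm
  · simp [gaussLogTerm]
  have hm' : (0 : ℝ) < m := by exact_mod_cast hm
  have hpow : ‖q‖ ^ m = (Real.exp (m * h))⁻¹ := by
    rw [hq, ← Real.exp_nat_mul, ← Real.exp_neg]; ring_nf
  have hE : m * h + 1 ≤ Real.exp (m * h) := Real.add_one_le_exp _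
  have hmh : 0 < m * h := by positivity
  have hle := one_sub_norm_pow_le q m
  rw [hpow] at hle
  have hE0 := Real.exp_pos (m * h)
  set E := Real.exp (m * h)
  have hinv : E⁻¹ * (m * h + 1) ≤ 1 := by
    rw [inv_mul_le_iff₀ hE0]; linarith
  have hpos : 0 < ‖1 + q ^ m‖ := by
    have : E⁻¹ * (m * h) > 0 := by positivity
    nlinarith
  rw [gaussLogTerm, hpow, one_div_mul_one_div, div_le_div_iff₀ (by positivity) (by positivity)]
  have : E⁻¹ * (m * h) ≤ ‖1 + q ^ m‖ := by linarith
  nlinarith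

lemma summable_gaussLogTerm {q : ℂ} {h : ℝ} (hh : 0 < h) (hq : ‖q‖ = Real.exp (-h)) :
    Summable (gaussLogTerm q) :=
  Summable.of_nonneg_of_le (gaussLogTerm_nonneg q) (gaussLogTerm_le hh hq)
    (hasSum_zeta_two.summable.mul_left _)

lemma norm_sum_alternating_pow_div_le {q : ℂ} (hq : ‖q‖ < 1) (n m : ℕ) :
    ‖∑ k ∈ Finset.range n, ((q ^ (2 * k + 1)) ^ m / m - (q ^ (2 * k + 2)) ^ m / m)‖ ≤
      (1 + ‖q‖ ^ (2 * n)) * gaussLogTerm q m := by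
  rcases Nat.eq_zero_or_pos m with rfl | hm
  · simp [gaussLogTerm]
  have hm' : (0 : ℝ) < m := by exact_mod_cast hm
  have key : (∑ k ∈ Finset.range n, ((q ^ (2 * k + 1)) ^ m / m - (q ^ (2 * k + 2)) ^ m / m))
      * (m * (1 + q ^ m)) = q ^ m * (1 - q ^ (2 * n * m)) := by
    have hm0 : (m : ℂ) ≠ 0 := by exact_mod_cast hm.ne'
    induction n with
    | zero => simp
    | succ n ih =>
      rw [Finset.sum_range_succ, add_mul, ih]
      field_simp
      ring
  have hpos : 0 < ‖1 + q ^ m‖ :=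
    lt_of_lt_of_le (sub_pos.mpr (pow_lt_one₀ (norm_nonneg q) hq hm.ne')) (one_sub_norm_pow_le q m)
  have hkey := congrArg norm key
  rw [norm_mul, norm_mul, norm_mul, norm_pow, Complex.norm_natCast] at hkey
  have hb : ‖1 - q ^ (2 * n * m)‖ ≤ 1 + ‖q‖ ^ (2 * n) := by
    refine (norm_sub_le _ _).trans ?_
    rw [norm_one, norm_pow]
    gcongr 1 + ?_
    exact pow_le_pow_of_le_one (norm_nonneg q) hq.le (Nat.le_mul_of_pos_right _ hm)
  rw [gaussLogTerm, ← mul_div_assoc, le_div_iff₀ (by positivity), hkey, mul_comm]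
  gcongr

/-- Lower bound for the partial Gauss products. -/
lemma exp_neg_le_norm_gaussProd {q : ℂ} {h : ℝ} (hh : 0 < h) (hq : ‖q‖ = Real.exp (-h)) (n : ℕ) :
    Real.exp (-((1 + ‖q‖ ^ (2 * n)) * ∑' m, gaussLogTerm q m)) ≤ ‖gaussProd q n‖ := by
  have hq1 : ‖q‖ < 1 := by rw [hq]; exact Real.exp_lt_one_iff.mpr (by linarith)
  have hlt : ∀ k : ℕ, k ≠ 0 → ‖q ^ k‖ < 1 := fun k hk ↦ by
    rw [norm_pow]; exact pow_lt_one₀ (norm_nonneg q) hq1 hk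
  set L : ℂ := ∑ k ∈ Finset.range n,
    (-Complex.log (1 - q ^ (2 * k + 1)) - -Complex.log (1 - q ^ (2 * k + 2))) with hL
  have hexp : gaussProd q n = Complex.exp L := by
    rw [hL, Complex.exp_sum, gaussProd]
    refine Finset.prod_congr rfl fun k _ ↦ ?_
    rw [neg_sub_neg, Complex.exp_sub,
      Complex.exp_log (one_sub_pow_ne_zero_of_norm_lt_one hq1 (by omega)),
      Complex.exp_log (one_sub_pow_ne_zero_of_norm_lt_one hq1 (by omega))]
  have hsum : HasSum (fun m : ℕ ↦ ∑ k ∈ Finset.range n,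
      ((q ^ (2 * k + 1)) ^ m / m - (q ^ (2 * k + 2)) ^ m / m)) L :=
    hasSum_sum fun k _ ↦ (Complex.hasSum_taylorSeries_neg_log (hlt _ (by omega))).sub
      (Complex.hasSum_taylorSeries_neg_log (hlt _ (by omega)))
  have hnorm : ‖L‖ ≤ (1 + ‖q‖ ^ (2 * n)) * ∑' m, gaussLogTerm q m := by
    rw [← hsum.tsum_eq]
    exact tsum_of_norm_bounded ((summable_gaussLogTerm hh hq).hasSum.mul_left _)
      (norm_sum_alternating_pow_div_le hq1 n)
  rw [hexp, Complex.norm_exp]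
  gcongr
  have := (abs_le.mp (Complex.abs_re_le_norm L)).1
  linarith

lemma summable_pow_triangular {q : ℂ} (hq : ‖q‖ < 1) :
    Summable fun s : ℕ ↦ q ^ (s * (s + 1) / 2) := by
  refine Summable.of_norm_bounded (summable_geometric_of_lt_one (norm_nonneg q) hq) fun s ↦ ?_
  rw [norm_pow]
  refine pow_le_pow_of_le_one (norm_nonneg q) hq.le ?_
  rw [Nat.le_div_iff_mul_le two_pos]
  rcases Nat.eq_zero_or_pos s with rfl | hs
  · simp
  · exact Nat.mul_le_mul_left s (by omega)

/-- Lower bound for the generating series of the triangular numbers. -/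
lemma exp_neg_le_norm_tsum_pow_triangular {q : ℂ} {h : ℝ} (hh : 0 < h)
    (hq : ‖q‖ = Real.exp (-h)) :
    Real.exp (-∑' m, gaussLogTerm q m) ≤ ‖∑' s : ℕ, q ^ (s * (s + 1) / 2)‖ := by
  have hq1 : ‖q‖ < 1 := by rw [hq]; exact Real.exp_lt_one_iff.mpr (by linarith)
  set B := ∑' m, gaussLogTerm q m
  have hB0 : 0 ≤ B := tsum_nonneg (gaussLogTerm_nonneg q)
  have hr : Filter.Tendsto (fun n : ℕ ↦ ‖q‖ ^ (2 * n)) Filter.atTop (nhds 0) :=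
    (tendsto_pow_atTop_nhds_zero_of_lt_one (norm_nonneg q) hq1).comp
      (Filter.tendsto_id.const_mul_atTop' two_pos)
  have hnr : Filter.Tendsto (fun n : ℕ ↦ (n : ℝ) * (‖q‖ ^ n)) Filter.atTop (nhds 0) :=
    tendsto_self_mul_const_pow_of_lt_one (norm_nonneg q) hq1
  have hsum := ((summable_pow_triangular hq1).hasSum.tendsto_sum_nat.comp
      (Filter.tendsto_id.const_mul_atTop' two_pos)).norm
  have hlow : Filter.Tendsto (fun n : ℕ ↦ Real.exp (-((1 + ‖q‖ ^ (2 * n)) * B))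
      * (1 - (n : ℝ) * ‖q‖ ^ n * Real.exp (2 * B))) Filter.atTop
      (nhds (Real.exp (-((1 + 0) * B)) * (1 - 0 * Real.exp (2 * B)))) := by
    refine Filter.Tendsto.mul ?_ (tendsto_const_nhds.sub (hnr.mul_const _))
    exact (Real.continuous_exp.tendsto _).comp ((hr.const_add 1).mul_const B).neg
  have hone : Filter.Tendsto (fun n : ℕ ↦ 1 - (n : ℝ) * ‖q‖ ^ n * Real.exp (2 * B)) Filter.atTop
      (nhds (1 - 0 * Real.exp (2 * B))) := tendsto_const_nhds.sub (hnr.mul_const _)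
  rw [show Real.exp (-((1 + 0) * B)) * (1 - 0 * Real.exp (2 * B)) = Real.exp (-B) by simp] at hlow
  refine le_of_tendsto_of_tendsto hlow hsum ?_
  filter_upwards [hone.eventually (eventually_ge_nhds (show (0 : ℝ) < _ by simp)), Filter.eventually_gt_atTop 0]
    with n hn hn0
  simp only [Function.comp_apply, id]
  rw [sum_pow_triangular_eq hq1]
  obtain ⟨k, rfl⟩ : ∃ k, n = k + 1 := ⟨n - 1, by omega⟩
  have hfac : ∑ s ∈ Finset.range (k + 1),
      gaussProd q (k + 1) / gaussProd q s * q ^ (s * (2 * (k + 1) + 1)) =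
      gaussProd q (k + 1) * (1 + ∑ s ∈ Finset.range k,
        q ^ ((s + 1) * (2 * (k + 1) + 1)) / gaussProd q (s + 1)) := by
    rw [Finset.sum_range_succ', add_comm (Finset.sum _ _), mul_add (gaussProd q (k + 1)), Finset.mul_sum]
    congr 1
    · simp [gaussProd]
    · exact Finset.sum_congr rfl fun s _ ↦ by ring
  rw [hfac, norm_mul]
  refine mul_le_mul (exp_neg_le_norm_gaussProd hh hq _) ?_ hn (norm_nonneg _)
  have htail : ‖∑ s ∈ Finset.range k,
      q ^ ((s + 1) * (2 * (k + 1) + 1)) / gaussProd q (s + 1)‖ ≤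
      ((k + 1 : ℕ) : ℝ) * ‖q‖ ^ (k + 1) * Real.exp (2 * B) := by
    have hterm : ∀ s ∈ Finset.range k,
        ‖q ^ ((s + 1) * (2 * (k + 1) + 1)) / gaussProd q (s + 1)‖ ≤
          ‖q‖ ^ (k + 1) * Real.exp (2 * B) := fun s _ ↦ by
      have hP : Real.exp (-(2 * B)) ≤ ‖gaussProd q (s + 1)‖ := by
        refine le_trans ?_ (exp_neg_le_norm_gaussProd hh hq (s + 1))
        gcongr
        linarith [pow_le_one₀ (n := 2 * (s + 1)) (norm_nonneg q) hq1.le]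
      rw [norm_div, norm_pow, div_eq_mul_inv]
      refine mul_le_mul ?_ ?_ (by positivity) (by positivity)
      · refine pow_le_pow_of_le_one (norm_nonneg q) hq1.le ?_
        nlinarith
      · rw [← neg_neg (2 * B), Real.exp_neg (-(2 * B))]
        exact inv_anti₀ (Real.exp_pos _) hP
    refine (norm_sum_le_of_le _ hterm).trans ?_
    rw [Finset.sum_const, Finset.card_range, nsmul_eq_mul, mul_assoc]
    gcongr
    omega
  have := norm_sub_le_norm_add (1 : ℂ) (∑ s ∈ Finset.range k,
    q ^ ((s + 1) * (2 * (k + 1) + 1)) / gaussProd q (s + 1))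
  rw [norm_one] at this
  linarith

lemma norm_one_sub_pow_le {w : ℂ} (hw : ‖w‖ ≤ 1) (m : ℕ) : ‖1 - w ^ m‖ ≤ m * ‖1 - w‖ := by
  induction m with
  | zero => simp
  | succ m ih =>
    have h : 1 - w ^ (m + 1) = (1 - w ^ m) + w ^ m * (1 - w) := by ring
    have hp : ‖w ^ m * (1 - w)‖ ≤ 1 * ‖1 - w‖ := by
      rw [norm_mul, norm_pow]
      gcongr
      exact pow_le_one₀ (norm_nonneg w) hw
    rw [h]
    refine (norm_add_le _ _).trans ?_
    push_cast
    linarith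

lemma tsum_gaussLogTerm_le_sub {q : ℂ} {h : ℝ} (hh : 0 < h) (hq : ‖q‖ = Real.exp (-h))
    (S : Finset ℕ) :
    ∑' m, gaussLogTerm q m ≤
      1 / h * (π ^ 2 / 6) - ∑ m ∈ S, (1 / h * (1 / (m : ℝ) ^ 2) - gaussLogTerm q m) := by
  have hs := (hasSum_zeta_two.mul_left (1 / h)).sub (summable_gaussLogTerm hh hq).hasSum
  have := sum_le_hasSum S (fun m _ ↦ sub_nonneg.mpr (gaussLogTerm_le hh hq m)) hs
  linarith

lemma gaussLogTerm_even_le {q : ℂ} (hq : ‖q‖ < 1) (hq' : 19 / 20 ≤ ‖q‖)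
    (hc : ‖1 + q‖ < 2 * (1 - ‖q‖)) {j : ℕ} (hj0 : 0 < j) (hj : j ≤ 5) :
    gaussLogTerm q (2 * j) ≤ 1 / (2 * j) := by
  have hj5 : (j : ℝ) ≤ 5 := by exact_mod_cast hj
  have hj0' : (0 : ℝ) < j := by exact_mod_cast hj0
  have h1 := norm_one_sub_pow_le (w := -q) (by rw [norm_neg]; exact hq.le) (2 * j)
  rw [sub_neg_eq_add, (even_two_mul j).neg_pow] at h1
  push_cast at h1
  have h2 : ‖1 - q ^ (2 * j)‖ ≤ 1 := by
    have : 2 * (j : ℝ) * ‖1 + q‖ ≤ 2 * 5 * (2 * (1 - ‖q‖)) := by gcongr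
    linarith
  have h3 : 1 ≤ ‖1 + q ^ (2 * j)‖ := by
    have h4 := norm_add_le (1 + q ^ (2 * j)) (1 - q ^ (2 * j))
    rw [show (1 + q ^ (2 * j)) + (1 - q ^ (2 * j)) = (2 : ℂ) by ring] at h4
    norm_num at h4
    linarith
  rw [gaussLogTerm]
  push_cast
  refine div_le_div₀ zero_le_one (pow_le_one₀ (norm_nonneg q) hq.le) (by positivity) ?_
  nlinarith

/-- Uniform bound for the logarithm of Gauss's product when `q` is close to the unit circle. -/
lemma tsum_gaussLogTerm_le {q : ℂ} {h : ℝ} (hh : 0 < h) (hq : ‖q‖ = Real.exp (-h))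
    (hh' : h ≤ 1 / 20) :
    ∑' m, gaussLogTerm q m ≤ 1 / h * (π ^ 2 / 6 - 9 / 25) + 2 := by
  have hq1 : ‖q‖ < 1 := by rw [hq]; exact Real.exp_lt_one_iff.mpr (by linarith)
  have hq2 : 19 / 20 ≤ ‖q‖ := by rw [hq]; linarith [Real.add_one_le_exp (-h)]
  have hinv : 0 < h⁻¹ := inv_pos.mpr hh
  by_cases hc : ‖1 + q‖ < 2 * (1 - ‖q‖)
  · have hS := tsum_gaussLogTerm_le_sub hh hq {2 * 1, 2 * 2, 2 * 3, 2 * 4, 2 * 5}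
    have h1 := gaussLogTerm_even_le hq1 hq2 hc (j := 1) (by norm_num) (by norm_num)
    have h2 := gaussLogTerm_even_le hq1 hq2 hc (j := 2) (by norm_num) (by norm_num)
    have h3 := gaussLogTerm_even_le hq1 hq2 hc (j := 3) (by norm_num) (by norm_num)
    have h4 := gaussLogTerm_even_le hq1 hq2 hc (j := 4) (by norm_num) (by norm_num)
    have h5 := gaussLogTerm_even_le hq1 hq2 hc (j := 5) (by norm_num) (by norm_num)
    norm_num at hS h1 h2 h3 h4 h5 ⊢
    linarith
  · have hS := tsum_gaussLogTerm_le_sub hh hq {1}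
    have h1 : gaussLogTerm q 1 ≤ 1 / h * (1 / 2) := by
      have hE : ‖q‖ * (h + 1) ≤ 1 := by
        rw [hq, Real.exp_neg, inv_mul_le_iff₀ (Real.exp_pos h)]
        linarith [Real.add_one_le_exp h]
      have hpos : 0 < ‖1 + q‖ := by linarith
      rw [gaussLogTerm, one_div_mul_one_div, pow_one, pow_one, Nat.cast_one, one_mul,
        div_le_div_iff₀ hpos (by positivity)]
      linarith
    rw [Finset.sum_singleton] at hS
    norm_num at hS h1 ⊢
    linarith

/-- At `z = 1/2` the theta function is the generating series of the triangular numbers. -/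
lemma norm_jtheta_half {τ : ℂ} (hτ : 0 < τ.im) :
    ‖jtheta (1 / 2) τ‖ = 2 * Real.exp (-(π * τ.im / 4)) *
      ‖∑' s : ℕ, Complex.exp (2 * π * Complex.I * τ) ^ (s * (s + 1) / 2)‖ := by
  set q := Complex.exp (2 * π * Complex.I * τ) with hqdef
  have hq1 : ‖q‖ < 1 := by
    rw [hqdef, Complex.norm_exp, Real.exp_lt_one_iff]
    simp
    positivity
  set c := -Complex.exp (π * Complex.I * τ / 4) with hc
  set f : ℤ → ℂ := fun n ↦ Complex.exp ((π : ℂ) * Complex.I * ((n : ℂ) + 1 / 2)) *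
    Complex.exp ((π : ℂ) * Complex.I * τ * ((n : ℂ) + 1 / 2) ^ 2) *
    Complex.exp (2 * (π : ℂ) * Complex.I * ((n : ℂ) + 1 / 2) * (1 / 2)) with hf
  have hfn : ∀ n : ℤ, f n = c * Complex.exp (π * Complex.I * τ * (n * (n + 1))) := fun n ↦ by
    have e : (π : ℂ) * Complex.I * ((n : ℂ) + 1 / 2) +
        (π : ℂ) * Complex.I * τ * ((n : ℂ) + 1 / 2) ^ 2 +
        2 * (π : ℂ) * Complex.I * ((n : ℂ) + 1 / 2) * (1 / 2) =
        n * (2 * π * Complex.I) + π * Complex.I + (π * Complex.I * τ / 4) +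
          π * Complex.I * τ * (n * (n + 1)) := by ring
    simp only [hf]
    rw [← Complex.exp_add, ← Complex.exp_add, e, Complex.exp_add, Complex.exp_add, Complex.exp_add,
      Complex.exp_int_mul_two_pi_mul_I, Complex.exp_pi_mul_I, hc]
    ring
  have hnat : ∀ n : ℕ, f n = c * q ^ (n * (n + 1) / 2) := fun n ↦ by
    rw [hfn, hqdef, ← Complex.exp_nat_mul]
    have : (((n * (n + 1) / 2 : ℕ) : ℂ)) = (n : ℂ) * (n + 1) / 2 := by
      rw [Nat.cast_div (Nat.even_mul_succ_self n).two_dvd two_ne_zero]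
      push_cast
      ring
    rw [this]
    congr 2
    push_cast
    ring
  have hneg : ∀ n : ℕ, f (-(n + 1)) = c * q ^ (n * (n + 1) / 2) := fun n ↦ by
    rw [← hnat, hfn, hfn]
    congr 2
    push_cast
    ring
  have hs : Summable fun n : ℕ ↦ c * q ^ (n * (n + 1) / 2) :=
    (summable_pow_triangular hq1).mul_left c
  have hj : jtheta (1 / 2) τ = 2 * c * ∑' s : ℕ, q ^ (s * (s + 1) / 2) := by
    change ∑' n : ℤ, f n = _
    rw [tsum_of_nat_of_neg_add_one (by simpa only [hnat] using hs) (by simpa only [hneg] using hs)]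
    simp only [hnat, hneg]
    rw [tsum_mul_left]
    ring
  have hcn : ‖c‖ = Real.exp (-(π * τ.im / 4)) := by
    rw [hc, norm_neg, Complex.norm_exp]
    congr 1
    rw [show (π : ℂ) * Complex.I * τ / 4 = ((π / 4 : ℝ) : ℂ) * (Complex.I * τ) by push_cast; ring,
      Complex.re_ofReal_mul]
    simp
    ring
  rw [hj, norm_mul, norm_mul, hcn]
  norm_num

/-- Upper bound for the reciprocal theta function near the real line, uniform in the real part. -/
lemma one_div_norm_jtheta_half_le {τ : ℂ} (hτ : 0 < τ.im) (hτ' : 2 * π * τ.im ≤ 1 / 20) :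
    1 / ‖jtheta (1 / 2) τ‖ ≤
      Real.exp 3 * Real.exp (1 / (2 * π * τ.im) * (π ^ 2 / 6 - 9 / 25)) := by
  have hh : 0 < 2 * π * τ.im := by positivity
  have hq : ‖Complex.exp (2 * π * Complex.I * τ)‖ = Real.exp (-(2 * π * τ.im)) := by
    rw [Complex.norm_exp]
    congr 1
    rw [show 2 * (π : ℂ) * Complex.I * τ = ((2 * π : ℝ) : ℂ) * (Complex.I * τ) by push_cast; ring,
      Complex.re_ofReal_mul]
    simp
  have h1 := exp_neg_le_norm_tsum_pow_triangular hh hq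
  have h2 := tsum_gaussLogTerm_le hh hq hτ'
  have h3 : Real.exp (-(3 + 1 / (2 * π * τ.im) * (π ^ 2 / 6 - 9 / 25))) ≤
      ‖jtheta (1 / 2) τ‖ := by
    rw [norm_jtheta_half hτ]
    calc _ ≤ Real.exp (-(π * τ.im / 4)) *
          Real.exp (-∑' m, gaussLogTerm (Complex.exp (2 * π * Complex.I * τ)) m) := by
            rw [← Real.exp_add]
            gcongr
            linarith
      _ ≤ 2 * Real.exp (-(π * τ.im / 4)) *
          Real.exp (-∑' m, gaussLogTerm (Complex.exp (2 * π * Complex.I * τ)) m) := by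
            gcongr
            linarith [Real.exp_pos (-(π * τ.im / 4))]
      _ ≤ _ := by gcongr
  rw [← Real.exp_add, ← neg_neg (3 + _), Real.exp_neg (-(3 + _)), ← one_div]
  exact one_div_le_one_div_of_le (Real.exp_pos _) h3

lemma exists_exp_neg_mul_sqrt_le {c : ℝ} (hc : 0 < c) :
    ∃ C : ℝ, 0 ≤ C ∧ ∀ n : ℕ, 1 ≤ n →
      Real.exp (-(c * Real.sqrt n)) ≤ C * (n : ℝ) ^ (-(3 : ℝ) / 4) := by
  refine ⟨2 / c ^ 2, by positivity, fun n hn ↦ ?_⟩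
  have hn1 : (1 : ℝ) ≤ n := by exact_mod_cast hn
  have hn0 : (0 : ℝ) < n := by linarith
  have h1 : (c * Real.sqrt n) ^ 2 / 2 ≤ Real.exp (c * Real.sqrt n) := by
    have := Real.quadratic_le_exp_of_nonneg (x := c * Real.sqrt n) (by positivity)
    have : 0 ≤ c * Real.sqrt n := by positivity
    linarith
  rw [mul_pow, Real.sq_sqrt hn0.le] at h1
  have h2 : (n : ℝ)⁻¹ ≤ (n : ℝ) ^ (-(3 : ℝ) / 4) := by
    rw [← Real.rpow_neg_one]
    exact Real.rpow_le_rpow_of_exponent_le hn1 (by norm_num)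
  calc Real.exp (-(c * Real.sqrt n)) = (Real.exp (c * Real.sqrt n))⁻¹ := Real.exp_neg _
    _ ≤ (c ^ 2 * n / 2)⁻¹ := inv_anti₀ (by positivity) h1
    _ = 2 / c ^ 2 * (n : ℝ)⁻¹ := by field_simp
    _ ≤ _ := by gcongr

/-- Bound away from the dominant pole:
`1/ϑ(1/2;bτ) ≪ n^{-3/4} e^{(δ√n/(πb))(π²/6 - ε)}`
for `|u| > Mv`, `v = 1/(δ√n)`, `ε = 1 - 1/√(1+M²)`. -/
theorem jtheta_half_minor_arc_bound (M δ : ℝ) (hM : 0 < M) (hδ : 0 < δ)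
    (b : ℕ) (hb : 0 < b) :
    ∃ C : ℝ, ∃ N : ℕ, ∀ n : ℕ, N ≤ n → ∀ u v : ℝ,
      v = 1 / (δ * Real.sqrt n) → |u| > M * v →
      1 / ‖jtheta (1 / 2) ((b : ℂ) * ((u : ℂ) + (v : ℂ) * Complex.I))‖
        ≤ C * (n : ℝ) ^ (-(3 : ℝ) / 4) *
          Real.exp ((δ * Real.sqrt n / (π * b)) *
            (π ^ 2 / 6 - (1 - 1 / Real.sqrt (1 + M ^ 2)))) := by
  have hb' : (0 : ℝ) < b := by exact_mod_cast hb
  have hπ : (9.85 : ℝ) < π ^ 2 := by nlinarith [Real.pi_gt_d2]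
  obtain ⟨C, hC0, hC⟩ := exists_exp_neg_mul_sqrt_le
    (c := δ / (π * b) * (π ^ 2 / 12 - 41 / 50)) (mul_pos (by positivity) (by linarith))
  have hlim : Filter.Tendsto (fun n : ℕ ↦ 40 * π * b / δ * (Real.sqrt n)⁻¹) Filter.atTop
      (nhds (40 * π * b / δ * 0)) :=
    ((tendsto_inv_atTop_zero.comp Real.tendsto_sqrt_atTop).comp
      tendsto_natCast_atTop_atTop).const_mul _
  rw [mul_zero] at hlim
  obtain ⟨N, hN⟩ := Filter.eventually_atTop.mp
    ((hlim.eventually_le_const zero_lt_one).and (Filter.eventually_ge_atTop 1))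
  refine ⟨Real.exp 3 * C, N, fun n hn u v hv _ ↦ ?_⟩
  obtain ⟨hsmall, hn1⟩ := hN n hn
  have hs : 0 < Real.sqrt n := Real.sqrt_pos.mpr (by exact_mod_cast hn1)
  have him : ((b : ℂ) * ((u : ℂ) + (v : ℂ) * Complex.I)).im = b * v := by simp
  have hv0 : 0 < v := by rw [hv]; positivity
  have hsmall' : 2 * π * (b * v) ≤ 1 / 20 := by
    have : 2 * π * (b * v) = 40 * π * b / δ * (Real.sqrt n)⁻¹ / 20 := by
      rw [hv]; field_simp; norm_num
    linarith
  have hmain := one_div_norm_jtheta_half_le (τ := (b : ℂ) * ((u : ℂ) + (v : ℂ) * Complex.I))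
    (by rw [him]; positivity) (by rw [him]; exact hsmall')
  rw [him] at hmain
  have hexp : 1 / (2 * π * (b * v)) * (π ^ 2 / 6 - 9 / 25) =
      -(δ / (π * b) * (π ^ 2 / 12 - 41 / 50) * Real.sqrt n) +
        δ * Real.sqrt n / (π * b) * (π ^ 2 / 6 - 1) := by
    rw [hv]; field_simp; ring
  rw [hexp, Real.exp_add] at hmain
  refine hmain.trans ?_
  rw [mul_assoc (Real.exp 3) C, mul_assoc (Real.exp 3)]
  gcongr
  · exact hC n hn1
  · have : 0 ≤ 1 / Real.sqrt (1 + M ^ 2) := by positivity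
    linarith
end

section
/- Fix M > 0. As τ → 0 within the cone {τ = u+iv : v > 0, |u| ≤ Mv}, one has μ(5τ, 3τ; 12τ) ~ −e^{πi/(48τ)} / (4i sin(π/4) sin(5π/12) √(−12iτ)); i.e., the ratio of μ(5τ,3τ;12τ) to the right-hand side tends to 1 as v → 0 within the cone. -/
open Real Complex

/-- The normalized Appell sum. -/
noncomputable def appellMu (z₁ z₂ τ : ℂ) : ℂ :=
  (Complex.exp ((π : ℂ) * Complex.I * z₁) / jtheta z₂ τ) *
    ∑' n : ℤ, (-1 : ℂ) ^ n * Complex.exp ((π : ℂ) * Complex.I * τ * (n : ℂ) * ((n : ℂ) + 1)) *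
      Complex.exp (2 * (π : ℂ) * Complex.I * (n : ℂ) * z₂) /
      (1 - Complex.exp (2 * (π : ℂ) * Complex.I * τ * (n : ℂ)) *
        Complex.exp (2 * (π : ℂ) * Complex.I * z₁))

open Filter Topology

/-- Mittag-Leffler expansion of the cosecant. -/
lemma pi_div_sin_pi_mul_eq {x : ℂ} (hx : x ∈ integerComplement) :
    (π : ℂ) / Complex.sin (π * x) = 1 / x +
      ∑' n : ℕ, (-1 : ℂ) ^ (n + 1) * (1 / (x - (n + 1)) + 1 / (x + (n + 1))) := by
  have hx2 : x / 2 ∈ integerComplement := by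
    rw [mem_integerComplement_iff] at hx ⊢
    rintro ⟨n, hn⟩
    exact hx ⟨2 * n, by push_cast; rw [hn]; ring⟩
  have hs := sin_pi_mul_ne_zero hx
  have hs2 := sin_pi_mul_ne_zero hx2
  have hsum := summable_cotTerm hx
  have hodd : Summable fun k : ℕ ↦ cotTerm x (2 * k + 1) :=
    hsum.comp_injective (i := fun k : ℕ ↦ 2 * k + 1) fun a b h ↦ by simpa using h
  have heven : Summable fun k : ℕ ↦ cotTerm x (2 * k) :=
    hsum.comp_injective (i := fun k : ℕ ↦ 2 * k) fun a b h ↦ by simpa using h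
  have key : HasSum (fun n : ℕ ↦ (-1 : ℂ) ^ (n + 1) * cotTerm x n)
      (-(∑' k : ℕ, cotTerm x (2 * k)) + ∑' k : ℕ, cotTerm x (2 * k + 1)) := by
    refine HasSum.even_add_odd ?_ ?_
    · simpa [pow_succ, pow_mul] using heven.hasSum.neg
    · simpa [pow_succ, pow_mul] using hodd.hasSum
  have hhalf : ∀ k : ℕ, cotTerm (x / 2) k = 2 * cotTerm x (2 * k + 1) := by
    intro k
    have h1 : x - (2 * k + 2) ≠ 0 := by
      simpa [sub_eq_add_neg] using integerComplement_add_ne_zero hx (-(2 * k + 2) : ℤ)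
    have h2 : x + (2 * k + 2) ≠ 0 := by
      simpa using integerComplement_add_ne_zero hx (2 * k + 2 : ℤ)
    have e1 : x / 2 - (k + 1) = (x - (2 * k + 2)) / 2 := by ring
    have e2 : x / 2 + (k + 1) = (x + (2 * k + 2)) / 2 := by ring
    have e3 : x - (((2 * k + 1 : ℕ) : ℂ) + 1) = x - (2 * k + 2) := by push_cast; ring
    have e4 : x + (((2 * k + 1 : ℕ) : ℂ) + 1) = x + (2 * k + 2) := by push_cast; ring
    simp only [cotTerm]
    rw [e1, e2, e3, e4]
    field_simp
  have c1 := cot_series_rep' hx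
  have c2 := cot_series_rep' hx2
  have c3 : ∑' n : ℕ, (1 / (x / 2 - (n + 1)) + 1 / (x / 2 + (n + 1))) =
      2 * ∑' k : ℕ, cotTerm x (2 * k + 1) := by
    rw [← tsum_mul_left]
    exact tsum_congr hhalf
  have c4 := tsum_even_add_odd heven hodd
  rw [c3] at c2
  rw [key.tsum_eq]
  have c5 : (π : ℂ) / Complex.sin (π * x) = π * cot (π * (x / 2)) - π * cot (π * x) := by
    have e : (π : ℂ) * x = 2 * (π * (x / 2)) := by ring
    rw [e] at hs ⊢
    simp only [Complex.cot]
    rw [Complex.cos_two_mul]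
    rw [Complex.sin_two_mul] at hs ⊢
    have hc : Complex.cos (π * (x / 2)) ≠ 0 := fun h ↦ hs (by rw [h]; ring)
    field_simp
    ring
  have c6 : 1 / (x / 2) = 2 * (1 / x) := by field_simp
  rw [c5]
  rw [c6] at c2
  simp only [cotTerm] at c4 c2 ⊢
  linear_combination c2 - c1 + c4

lemma norm_one_sub_cexp_le {s : ℂ} (hs : s.re ≤ 0) : ‖1 - cexp s‖ ≤ 2 * ‖s‖ := by
  rcases le_or_gt ‖s‖ 1 with h | h
  · rw [norm_sub_rev]; exact norm_exp_sub_one_le h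
  · have h1 : ‖cexp s‖ ≤ 1 := by rw [Complex.norm_exp]; exact Real.exp_le_one_iff.mpr hs
    have := norm_sub_le (1 : ℂ) (cexp s)
    rw [norm_one] at this
    linarith

/-- The power `q ^ a`, where `q = exp (2 * π * I * τ)`. -/
noncomputable def qPow (τ a : ℂ) : ℂ := cexp (2 * π * I * τ * a)

lemma qPow_add (τ a b : ℂ) : qPow τ (a + b) = qPow τ a * qPow τ b := by
  rw [qPow, qPow, qPow, ← Complex.exp_add]; ring_nf

lemma norm_qPow (τ : ℂ) (a : ℝ) : ‖qPow τ a‖ = Real.exp (-(2 * π * τ.im * a)) := by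
  rw [qPow, Complex.norm_exp]
  congr 1
  simp

lemma tendsto_qPow (a : ℂ) : Tendsto (fun τ ↦ qPow τ a) (𝓝 0) (𝓝 1) := by
  have : Continuous fun τ ↦ qPow τ a := by unfold qPow; fun_prop
  simpa [qPow] using this.tendsto 0

lemma tendsto_div_one_sub_qPow {a : ℂ} (ha : a ≠ 0) :
    Tendsto (fun τ ↦ τ / (1 - qPow τ a)) (𝓝[≠] 0) (𝓝 (-1 / (2 * π * I * a))) := by
  have hd : HasDerivAt (fun τ ↦ qPow τ a) (2 * π * I * a) 0 := by
    have h : HasDerivAt (fun τ : ℂ ↦ 2 * π * I * τ * a) (2 * π * I * a) 0 := by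
      simpa using ((hasDerivAt_id (0 : ℂ)).const_mul (2 * π * I)).mul_const a
    simpa [qPow] using h.cexp
  have hne : 2 * π * I * a ≠ 0 := by simp [ha, pi_ne_zero]
  have := ((hasDerivAt_iff_tendsto_slope.mp hd).inv₀ hne).neg
  refine (this.congr fun τ ↦ ?_).trans (by rw [neg_div, one_div])
  rw [slope_def_field, inv_div]
  simp only [qPow, mul_zero, zero_mul, Complex.exp_zero, sub_zero]
  rw [← div_neg, neg_sub]

lemma le_norm_one_sub_qPow {τ : ℂ} (hτ : 0 < τ.im) {a m : ℝ} (hm : m ≤ a) :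
    1 - Real.exp (-(2 * π * τ.im * m)) ≤ ‖1 - qPow τ a‖ := by
  have h := norm_sub_norm_le (1 : ℂ) (qPow τ a)
  rw [norm_one, norm_qPow] at h
  have : Real.exp (-(2 * π * τ.im * a)) ≤ Real.exp (-(2 * π * τ.im * m)) := by
    gcongr
  linarith

lemma inv_norm_one_sub_qPow_le {τ : ℂ} (hτ : 0 < τ.im) {a m : ℝ} (h0 : 0 < m) (hm : m ≤ a) :
    ‖1 - qPow τ a‖⁻¹ ≤ (1 + 2 * π * τ.im * m) / (2 * π * τ.im * m) := by
  have hx : 0 < 2 * π * τ.im * m := by positivity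
  have h1 := le_norm_one_sub_qPow hτ hm
  set x := 2 * π * τ.im * m
  have h2 : Real.exp (-x) ≤ 1 / (1 + x) := by
    rw [Real.exp_neg, ← one_div]
    gcongr
    linarith [Real.add_one_le_exp x]
  have h3 : x / (1 + x) ≤ ‖1 - qPow τ a‖ := by
    have : x / (1 + x) = 1 - 1 / (1 + x) := by field_simp; ring
    linarith
  have h4 := inv_anti₀ (by positivity) h3
  rwa [inv_div] at h4

/-- The summand of the Appell sum at `(5 * τ, 3 * τ; 12 * τ)`. -/
noncomputable def appellTerm (τ : ℂ) (n : ℤ) : ℂ :=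
  (-1 : ℂ) ^ n * qPow τ (6 * n ^ 2 + 9 * n) / (1 - qPow τ (12 * n + 5))

lemma one_sub_qPow_ne_zero {τ : ℂ} (hτ : 0 < τ.im) {a : ℝ} (ha : a ≠ 0) : 1 - qPow τ a ≠ 0 := by
  intro h
  have h1 : ‖qPow τ a‖ = 1 := by rw [← sub_eq_zero.mp h, norm_one]
  rw [norm_qPow, Real.exp_eq_one_iff] at h1
  have : 2 * π * τ.im * a ≠ 0 := by positivity
  exact this (by linarith)

lemma qPow_neg (τ a : ℂ) : qPow τ (-a) = (qPow τ a)⁻¹ := by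
  rw [qPow, qPow, ← Complex.exp_neg]; ring_nf

lemma appellTerm_add_neg {τ : ℂ} (hτ : 0 < τ.im) (m : ℕ) :
    appellTerm τ m + appellTerm τ (-m) = (-1) ^ m * qPow τ ((6 * m ^ 2 + 3 * m - 5 : ℝ) : ℂ) *
      (-(1 - qPow τ ((6 * m + 5 : ℝ) : ℂ)) / (1 - qPow τ ((12 * m - 5 : ℝ) : ℂ)) -
        qPow τ ((18 * m : ℝ) : ℂ) * (1 - qPow τ ((10 : ℝ) : ℂ)) /
        ((1 - qPow τ ((12 * m + 5 : ℝ) : ℂ)) * (1 - qPow τ ((12 * m - 5 : ℝ) : ℂ)))) := by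
  have h1 : 1 - qPow τ ((12 * m + 5 : ℝ) : ℂ) ≠ 0 := one_sub_qPow_ne_zero hτ (by positivity)
  have h2 : 1 - qPow τ ((12 * m - 5 : ℝ) : ℂ) ≠ 0 := by
    refine one_sub_qPow_ne_zero hτ ?_
    rw [sub_ne_zero]
    norm_cast
    omega
  have hz : ∀ a, qPow τ a ≠ 0 := fun a ↦ Complex.exp_ne_zero _
  have e1 : appellTerm τ m =
      (-1) ^ m * qPow τ ((6 * m ^ 2 + 3 * m - 5 : ℝ) : ℂ) * qPow τ ((6 * m + 5 : ℝ) : ℂ) /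
        (1 - qPow τ ((12 * m + 5 : ℝ) : ℂ)) := by
    rw [mul_assoc, ← qPow_add, appellTerm, zpow_natCast]
    push_cast
    ring_nf
  have e2 : appellTerm τ (-m) =
      -((-1) ^ m * qPow τ ((6 * m ^ 2 + 3 * m - 5 : ℝ) : ℂ)) /
        (1 - qPow τ ((12 * m - 5 : ℝ) : ℂ)) := by
    have e3 : ((6 * m ^ 2 + 3 * m - 5 : ℝ) : ℂ) =
      (6 * m ^ 2 - 9 * m) + ((12 * m - 5 : ℝ) : ℂ) := by push_cast; ring
    have e4 : qPow τ (12 * ((-m : ℤ) : ℂ) + 5) = (qPow τ ((12 * m - 5 : ℝ) : ℂ))⁻¹ := by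
      rw [← qPow_neg]; push_cast; ring_nf
    have e5 : qPow τ (6 * ((-m : ℤ) : ℂ) ^ 2 + 9 * ((-m : ℤ) : ℂ)) =
        qPow τ (6 * m ^ 2 - 9 * m) := by push_cast; ring_nf
    rw [appellTerm, e4, e5, e3, qPow_add, zpow_neg, zpow_natCast, ← inv_pow]
    have := hz ((12 * m - 5 : ℝ) : ℂ)
    rw [show (-1 : ℂ)⁻¹ = -1 by norm_num]
    rw [show 1 - (qPow τ ((12 * m - 5 : ℝ) : ℂ))⁻¹ =
      -(1 - qPow τ ((12 * m - 5 : ℝ) : ℂ)) / qPow τ ((12 * m - 5 : ℝ) : ℂ) by field_simp; ring]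
    field_simp
  have f1 : qPow τ ((18 * m : ℝ) : ℂ) * qPow τ ((10 : ℝ) : ℂ) =
      qPow τ ((6 * m + 5 : ℝ) : ℂ) * qPow τ ((12 * m + 5 : ℝ) : ℂ) := by
    rw [← qPow_add, ← qPow_add]; push_cast; ring_nf
  have f2 : qPow τ ((18 * m : ℝ) : ℂ) =
      qPow τ ((6 * m + 5 : ℝ) : ℂ) * qPow τ ((12 * m - 5 : ℝ) : ℂ) := by
    rw [← qPow_add]; push_cast; ring_nf
  rw [e1, e2]
  generalize (-1) ^ m * qPow τ ((6 * m ^ 2 + 3 * m - 5 : ℝ) : ℂ) = A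
  generalize qPow τ ((12 * m + 5 : ℝ) : ℂ) = B at *
  generalize qPow τ ((12 * m - 5 : ℝ) : ℂ) = C at *
  generalize qPow τ ((18 * m : ℝ) : ℂ) = D at *
  generalize qPow τ ((6 * m + 5 : ℝ) : ℂ) = E at *
  field_simp
  linear_combination A * (f2 - f1)

lemma norm_mul_appellTerm_add_neg_le {τ : ℂ} {K : ℝ} (hτ : 0 < τ.im) (hK : ‖τ‖ ≤ K * τ.im)
    {m : ℕ} (hm : 1 ≤ m) :
    ‖τ * (appellTerm τ m + appellTerm τ (-m))‖ ≤ 32 * K ^ 2 * (1 / (m : ℝ) ^ 2) := by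
  have hm' : (1 : ℝ) ≤ m := by exact_mod_cast hm
  have hK0 : 0 < K := by
    have : 0 < ‖τ‖ := by rw [norm_pos_iff]; rintro rfl; simp at hτ
    exact pos_of_mul_pos_left (this.trans_le hK) hτ.le
  have hpi := pi_gt_three
  set v := τ.im with hvdef
  set x := 2 * π * v * m with hxdef
  have hx : 0 < x := by positivity
  have hb : ∀ a : ℝ, 0 ≤ a → ‖1 - qPow τ a‖ ≤ 4 * π * K * v * a := by
    intro a ha
    have h := norm_one_sub_cexp_le (s := 2 * π * I * τ * a) (by simp; positivity)
    refine h.trans ?_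
    have : ‖2 * π * I * τ * (a : ℂ)‖ = 2 * π * ‖τ‖ * a := by
      simp [abs_of_nonneg ha, abs_of_pos pi_pos]
    rw [this]
    calc 2 * (2 * π * ‖τ‖ * a) = 4 * π * ‖τ‖ * a := by ring
      _ ≤ 4 * π * (K * v) * a := by gcongr
      _ = _ := by ring
  have d1 : ‖1 - qPow τ ((12 * m + 5 : ℝ) : ℂ)‖⁻¹ ≤ (1 + x) / x :=
    inv_norm_one_sub_qPow_le hτ (by linarith) (by linarith)
  have d2 : ‖1 - qPow τ ((12 * m - 5 : ℝ) : ℂ)‖⁻¹ ≤ (1 + x) / x :=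
    inv_norm_one_sub_qPow_le hτ (by linarith) (by linarith)
  have n1 : ‖1 - qPow τ ((6 * m + 5 : ℝ) : ℂ)‖ ≤ 22 * K * x := by
    refine (hb _ (by linarith)).trans ?_
    calc 4 * π * K * v * (6 * m + 5) ≤ 4 * π * K * v * (11 * m) := by gcongr; linarith
      _ = _ := by rw [hxdef]; ring
  have n2 : ‖1 - qPow τ ((10 : ℝ) : ℂ)‖ ≤ 40 * π * K * v :=
    (hb _ (by norm_num)).trans (by linarith)
  have g1 : Real.exp (-x) * (1 + x) ≤ 1 := by
    rw [Real.exp_neg, inv_mul_le_iff₀ (Real.exp_pos x)]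
    linarith [Real.add_one_le_exp x]
  have g2 : v * Real.exp (-(2 * π * v * m ^ 2)) ≤ 1 / m ^ 2 := by
    have h := Real.add_one_le_exp (2 * π * v * m ^ 2)
    rw [Real.exp_neg, mul_inv_le_iff₀ (Real.exp_pos _), one_div, le_inv_mul_iff₀ (by positivity)]
    have : 0 ≤ v * m ^ 2 := by positivity
    nlinarith
  have q1 : ‖qPow τ ((6 * m ^ 2 + 3 * m - 5 : ℝ) : ℂ)‖ ≤
      Real.exp (-(2 * π * v * m ^ 2)) * Real.exp (-x) := by
    rw [norm_qPow, ← Real.exp_add]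
    gcongr
    have : (m : ℝ) ^ 2 + m ≤ 6 * m ^ 2 + 3 * m - 5 := by nlinarith
    calc -(2 * π * v * (6 * m ^ 2 + 3 * m - 5)) ≤ -(2 * π * v * (m ^ 2 + m)) := by gcongr
      _ = _ := by rw [hxdef]; ring
  have q2 : ‖qPow τ ((18 * m : ℝ) : ℂ)‖ ≤ Real.exp (-x) := by
    rw [norm_qPow]
    gcongr
    rw [hxdef]
    gcongr
    linarith
  have q3 : Real.exp (-(2 * π * v * m ^ 2)) ≤ 1 :=
    Real.exp_le_one_iff.mpr (by have : 0 ≤ 2 * π * v * m ^ 2 := by positivity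
                                linarith)
  have hE := Real.exp_pos (-x)
  rw [appellTerm_add_neg hτ, norm_mul, norm_mul, norm_mul, norm_pow, norm_neg, norm_one, one_pow,
    one_mul]
  have t1 : ‖-(1 - qPow τ ((6 * m + 5 : ℝ) : ℂ)) / (1 - qPow τ ((12 * m - 5 : ℝ) : ℂ))‖ ≤
      22 * K * (1 + x) := by
    rw [norm_div, norm_neg, div_eq_mul_inv]
    calc _ ≤ 22 * K * x * ((1 + x) / x) := by gcongr
      _ = _ := by field_simp
  have t2 : ‖qPow τ ((18 * m : ℝ) : ℂ) * (1 - qPow τ ((10 : ℝ) : ℂ)) /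
        ((1 - qPow τ ((12 * m + 5 : ℝ) : ℂ)) * (1 - qPow τ ((12 * m - 5 : ℝ) : ℂ)))‖ ≤
      Real.exp (-x) * (40 * π * K * v) * (((1 + x) / x) * ((1 + x) / x)) := by
    rw [norm_div, norm_mul, norm_mul, div_eq_mul_inv, mul_inv]
    gcongr
  set E := Real.exp (-(2 * π * v * m ^ 2)) with hEdef
  have hEp : 0 < E := Real.exp_pos _
  calc _ ≤ K * v * ((E * Real.exp (-x)) * (22 * K * (1 + x) +
        Real.exp (-x) * (40 * π * K * v) * (((1 + x) / x) * ((1 + x) / x)))) := by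
        gcongr
        exact (norm_sub_le _ _).trans (add_le_add t1 t2)
    _ = 22 * K ^ 2 * (v * E) * (Real.exp (-x) * (1 + x)) +
        10 * K ^ 2 * E * (Real.exp (-x) * (1 + x)) ^ 2 * (1 / π) * (1 / m ^ 2) := by
        rw [hxdef]
        have : (m : ℝ) ≠ 0 := by positivity
        field_simp
        ring
    _ ≤ 22 * K ^ 2 * (1 / m ^ 2) * 1 + 10 * K ^ 2 * 1 * 1 ^ 2 * 1 * (1 / m ^ 2) := by
        gcongr
        rw [div_le_one pi_pos]
        linarith
    _ = _ := by ring

lemma summable_appellTerm {τ : ℂ} (hτ : 0 < τ.im) : Summable (appellTerm τ) := by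
  have h12 : 0 < (12 * τ).im := by simpa using hτ
  set c := 1 - Real.exp (-(2 * π * τ.im * 5)) with hc
  have hy : 0 < 2 * π * τ.im := by positivity
  have hc0 : 0 < c := by
    rw [hc, sub_pos, Real.exp_lt_one_iff]
    linarith
  have hden : ∀ n : ℤ, c ≤ ‖1 - qPow τ ((12 * n + 5 : ℝ) : ℂ)‖ := by
    intro n
    rcases le_or_gt 0 n with hn | hn
    · have : (0 : ℝ) ≤ n := by exact_mod_cast hn
      exact le_norm_one_sub_qPow hτ (by linarith)
    · have hn' : (n : ℝ) ≤ -1 := by exact_mod_cast Int.le_sub_one_of_lt hn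
      have h := norm_sub_norm_le (qPow τ ((12 * n + 5 : ℝ) : ℂ)) 1
      rw [norm_one, norm_qPow, norm_sub_rev] at h
      have h1 := Real.add_one_le_exp (-(2 * π * τ.im * (12 * n + 5)))
      have h2 := Real.add_one_le_exp (-(2 * π * τ.im * 5))
      nlinarith
  refine (((summable_jacobiTheta₂_term_iff (9 * τ) (12 * τ)).mpr h12).norm.mul_right
    c⁻¹).of_norm_bounded fun n ↦ ?_
  have e : appellTerm τ n = (-1 : ℂ) ^ n * jacobiTheta₂_term n (9 * τ) (12 * τ) /
      (1 - qPow τ ((12 * n + 5 : ℝ) : ℂ)) := by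
    rw [appellTerm, jacobiTheta₂_term, qPow]
    push_cast
    ring_nf
  rw [e, norm_div, norm_mul, norm_zpow, norm_neg, norm_one, one_zpow, one_mul, div_eq_mul_inv]
  gcongr
  exact hden n

/-- The cone of points `u + I * v` with `0 < v` and `|u| ≤ M * v`. -/
def upperCone (M : ℝ) : Set ℂ := {τ | 0 < τ.im ∧ |τ.re| ≤ M * τ.im}

lemma norm_le_of_mem_upperCone {M : ℝ} {τ : ℂ} (h : τ ∈ upperCone M) :
    ‖τ‖ ≤ (1 + M) * τ.im := by
  have := Complex.norm_le_abs_re_add_abs_im τ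
  rw [abs_of_pos h.1] at this
  linarith [h.2]

lemma nhdsWithin_upperCone_le (M : ℝ) : 𝓝[upperCone M] (0 : ℂ) ≤ 𝓝[≠] 0 :=
  nhdsWithin_mono _ fun τ h ↦ by
    rintro rfl
    exact absurd h.1 (by simp)

lemma tendsto_mul_appellTerm (M : ℝ) (n : ℤ) :
    Tendsto (fun τ ↦ τ * appellTerm τ n) (𝓝[upperCone M] 0)
      (𝓝 ((-1) ^ n * (-1 / (2 * π * I * (12 * n + 5))))) := by
  have ha : (12 * n + 5 : ℂ) ≠ 0 := by
    norm_cast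
    omega
  have h1 := (tendsto_div_one_sub_qPow ha).mono_left (nhdsWithin_upperCone_le M)
  have h2 := (tendsto_qPow (6 * n ^ 2 + 9 * n)).mono_left
    (nhdsWithin_le_nhds (s := upperCone M))
  have h3 := (h2.mul h1).const_mul ((-1 : ℂ) ^ n)
  rw [one_mul] at h3
  refine h3.congr fun τ ↦ ?_
  rw [appellTerm]
  ring

lemma tsum_int_eq_zero_add_tsum_pair {f : ℤ → ℂ} (hf : Summable f) :
    ∑' n, f n = f 0 + ∑' n : ℕ, (f ((n + 1 : ℕ) : ℤ) + f (-((n + 1 : ℕ) : ℤ))) := by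
  have h1 : Summable fun n : ℕ ↦ f ((n : ℤ) + 1) :=
    hf.comp_injective (i := fun n : ℕ ↦ (n : ℤ) + 1) fun a b h ↦ by simpa using h
  have h2 : Summable fun n : ℕ ↦ f (-((n : ℤ) + 1)) :=
    hf.comp_injective (i := fun n : ℕ ↦ -((n : ℤ) + 1)) fun a b h ↦ by simpa using h
  push_cast
  rw [tsum_of_add_one_of_neg_add_one h1 h2, h1.tsum_add h2]
  ring

lemma five_div_twelve_mem_integerComplement : (5 / 12 : ℂ) ∈ integerComplement := by
  rw [mem_integerComplement_iff]
  rintro ⟨n, hn⟩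
  have : (12 * n : ℂ) = 5 := by rw [hn]; norm_num
  have h : 12 * n = 5 := by exact_mod_cast this
  omega

lemma tendsto_mul_tsum_appellTerm (M : ℝ) :
    Tendsto (fun τ ↦ τ * ∑' n, appellTerm τ n) (𝓝[upperCone M] 0)
      (𝓝 (-1 / (24 * I * Complex.sin (π * (5 / 12))))) := by
  have hsum : Summable fun n : ℕ ↦ 32 * (1 + M) ^ 2 * (1 / ((n + 1 : ℕ) : ℝ) ^ 2) :=
    (((summable_nat_add_iff 1).mpr (Real.summable_one_div_nat_pow.mpr one_lt_two))).mul_left _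
  have hpair := tendsto_tsum_of_dominated_convergence hsum
    (fun n : ℕ ↦ (tendsto_mul_appellTerm M ((n + 1 : ℕ) : ℤ)).add
      (tendsto_mul_appellTerm M (-((n + 1 : ℕ) : ℤ)))) (by
      filter_upwards [self_mem_nhdsWithin] with τ hτ n
      rw [← mul_add]
      exact norm_mul_appellTerm_add_neg_le hτ.1 (norm_le_of_mem_upperCone hτ) (by omega))
  have hlim := (tendsto_mul_appellTerm M 0).add hpair
  have hval : -1 / (24 * I * Complex.sin (π * (5 / 12))) =
      (-1 : ℂ) ^ (0 : ℤ) * (-1 / (2 * π * I * (12 * (0 : ℤ) + 5))) +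
      ∑' n : ℕ, ((-1 : ℂ) ^ ((n + 1 : ℕ) : ℤ) *
          (-1 / (2 * π * I * (12 * (((n + 1 : ℕ) : ℤ) : ℂ) + 5))) +
        (-1 : ℂ) ^ (-((n + 1 : ℕ) : ℤ)) *
          (-1 / (2 * π * I * (12 * ((-((n + 1 : ℕ) : ℤ) : ℤ) : ℂ) + 5)))) := by
    have hpi : (π : ℂ) ≠ 0 := by exact_mod_cast pi_ne_zero
    have hs := sin_pi_mul_ne_zero five_div_twelve_mem_integerComplement
    have h := pi_div_sin_pi_mul_eq five_div_twelve_mem_integerComplement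
    have e : -1 / (24 * I * Complex.sin (π * (5 / 12))) =
        -1 / (24 * π * I) * (π / Complex.sin (π * (5 / 12))) := by field_simp
    rw [e, h, mul_add, ← tsum_mul_left]
    congr 1
    · push_cast
      rw [zpow_zero]
      field_simp
      ring
    · refine tsum_congr fun n ↦ ?_
      have h1 : (5 / 12 - (n + 1) : ℂ) ≠ 0 := by
        simpa [sub_eq_add_neg] using
          integerComplement_add_ne_zero five_div_twelve_mem_integerComplement (-(n + 1))
      have h2 : (5 / 12 + (n + 1) : ℂ) ≠ 0 := by
        simpa using
          integerComplement_add_ne_zero five_div_twelve_mem_integerComplement (n + 1)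
      have e1 : (12 * (((n + 1 : ℕ) : ℤ) : ℂ) + 5) = 12 * (5 / 12 + (n + 1)) := by
        push_cast; ring
      have e2 : (12 * ((-((n + 1 : ℕ) : ℤ) : ℤ) : ℂ) + 5) = 12 * (5 / 12 - (n + 1)) := by
        push_cast; ring
      have e3 : (-1 : ℂ) ^ (-((n + 1 : ℕ) : ℤ)) = (-1) ^ (n + 1) := by
        rw [zpow_neg, zpow_natCast, ← inv_pow]; norm_num
      rw [e1, e2, e3, zpow_natCast]
      generalize (5 / 12 + (n + 1) : ℂ) = a at *
      generalize (5 / 12 - (n + 1) : ℂ) = b at *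
      generalize (-1 : ℂ) ^ (n + 1) = s
      field_simp
      ring
  rw [hval]
  refine hlim.congr' ?_
  filter_upwards [self_mem_nhdsWithin] with τ hτ
  rw [tsum_int_eq_zero_add_tsum_pair (summable_appellTerm hτ.1), mul_add, ← tsum_mul_left]
  simp_rw [mul_add]

lemma jtheta_eq (z τ : ℂ) : jtheta z τ =
    I * cexp (π * I * τ / 4) * cexp (π * I * z) * jacobiTheta₂ (z + 1 / 2 + τ / 2) τ := by
  rw [jtheta, jacobiTheta₂, ← tsum_mul_left]
  refine tsum_congr fun n ↦ ?_
  have e : cexp (π * I * (n + 1 / 2)) * cexp (π * I * τ * (n + 1 / 2) ^ 2) *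
      cexp (2 * π * I * (n + 1 / 2) * z) = cexp (π / 2 * I) * cexp (π * I * τ / 4) *
      cexp (π * I * z) * cexp (2 * π * I * n * (z + 1 / 2 + τ / 2) + π * I * n ^ 2 * τ) := by
    simp only [← Complex.exp_add]
    congr 1
    ring
  rw [e, Complex.exp_pi_div_two_mul_I, jacobiTheta₂_term]

lemma tendsto_im_div_normSq (M : ℝ) (hM : 0 < M) :
    Tendsto (fun τ : ℂ ↦ τ.im / normSq τ) (𝓝[upperCone M] 0) atTop := by
  have h : Tendsto (fun τ : ℂ ↦ (1 + M)⁻¹ * ‖τ‖⁻¹) (𝓝[upperCone M] 0) atTop :=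
    ((tendsto_inv_nhdsGT_zero.comp tendsto_norm_nhdsNE_zero).mono_left
      (nhdsWithin_upperCone_le M)).const_mul_atTop (by positivity)
  refine tendsto_atTop_mono' _ ?_ h
  filter_upwards [self_mem_nhdsWithin] with τ hτ
  have h1 := norm_le_of_mem_upperCone hτ
  have h0 : 0 < ‖τ‖ := by
    rw [norm_pos_iff]
    rintro rfl
    simpa using hτ.1
  rw [normSq_eq_norm_sq, le_div_iff₀ (by positivity)]
  calc (1 + M)⁻¹ * ‖τ‖⁻¹ * ‖τ‖ ^ 2 = (1 + M)⁻¹ * ‖τ‖ := by field_simp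
    _ ≤ (1 + M)⁻¹ * ((1 + M) * τ.im) := by gcongr
    _ = τ.im := by field_simp

lemma jacobiTheta₂_term_inverted {τ : ℂ} (hτ : τ ≠ 0) (n : ℤ) :
    jacobiTheta₂_term n ((9 * τ + 1 / 2) / (12 * τ)) (-1 / (12 * τ)) =
      cexp (3 * π * I / 2 * n) * cexp (-(π * I * (n * (n - 1)) / 12) * τ⁻¹) := by
  rw [jacobiTheta₂_term, ← Complex.exp_add]
  congr 1
  field_simp
  ring

lemma norm_jacobiTheta₂_term_inverted {τ : ℂ} (hτ : τ ≠ 0) (n : ℤ) :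
    ‖jacobiTheta₂_term n ((9 * τ + 1 / 2) / (12 * τ)) (-1 / (12 * τ))‖ =
      Real.exp (-(π * (n * (n - 1)) / 12 * (τ.im / normSq τ))) := by
  have e1 : (3 * π * I / 2 * n : ℂ) = ((3 * π / 2 * n : ℝ) : ℂ) * I := by push_cast; ring
  have e2 : -(π * I * (n * (n - 1)) / 12) * τ⁻¹ =
      ((-(π * (n * (n - 1)) / 12) : ℝ) : ℂ) * (I * τ⁻¹) := by push_cast; ring
  rw [jacobiTheta₂_term_inverted hτ, norm_mul, e1, norm_exp_ofReal_mul_I, one_mul, e2,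
    Complex.norm_exp, re_ofReal_mul, I_mul_re, inv_im]
  congr 1
  ring

lemma tendsto_jacobiTheta₂_inverted (M : ℝ) (hM : 0 < M) :
    Tendsto (fun τ ↦ jacobiTheta₂ ((9 * τ + 1 / 2) / (12 * τ)) (-1 / (12 * τ)))
      (𝓝[upperCone M] 0) (𝓝 (1 - I)) := by
  have hne : ∀ᶠ τ in 𝓝[upperCone M] (0 : ℂ), τ ≠ 0 :=
    nhdsWithin_upperCone_le M self_mem_nhdsWithin
  have hX := tendsto_im_div_normSq M hM
  have hsum : ∑' n : ℤ, (if n = 0 then 1 else if n = 1 then -I else 0 : ℂ) = 1 - I := by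
    rw [tsum_eq_sum (s := {0, 1}) (by
      intro n hn
      simp only [Finset.mem_insert, Finset.mem_singleton, not_or] at hn
      simp [hn.1, hn.2])]
    simp [sub_eq_add_neg]
  rw [← hsum]
  refine tendsto_tsum_of_dominated_convergence
    (summable_pow_mul_jacobiTheta₂_term_bound (1 / 2) one_pos 0) (fun n ↦ ?_) ?_
  · have h3 : cexp (3 * π * I / 2) = -I := by
      rw [show (3 * π * I / 2 : ℂ) = π * I + π / 2 * I by ring, Complex.exp_add,
        Complex.exp_pi_mul_I, Complex.exp_pi_div_two_mul_I, neg_one_mul]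
    split_ifs with h0 h1
    · refine tendsto_const_nhds.congr' ?_
      filter_upwards [hne] with τ hτ
      rw [jacobiTheta₂_term_inverted hτ]
      simp [h0]
    · refine tendsto_const_nhds.congr' ?_
      filter_upwards [hne] with τ hτ
      rw [jacobiTheta₂_term_inverted hτ]
      simp [h1, h3]
    · rw [tendsto_zero_iff_norm_tendsto_zero]
      have hn : (0 : ℝ) < n * (n - 1) := by
        have : 0 < n * (n - 1) := by
          rcases lt_or_gt_of_ne h0 with h | h
          · nlinarith
          · exact mul_pos h (by omega)
        exact_mod_cast this
      have := Real.tendsto_exp_neg_atTop_nhds_zero.comp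
        (hX.const_mul_atTop (show 0 < π * (n * (n - 1)) / 12 by positivity))
      refine this.congr' ?_
      filter_upwards [hne] with τ hτ
      rw [norm_jacobiTheta₂_term_inverted hτ]
      rfl
  · filter_upwards [hne, hX.eventually_ge_atTop 12] with τ hτ hX n
    rw [norm_jacobiTheta₂_term_inverted hτ, pow_zero, one_mul]
    gcongr
    have hn : (0 : ℝ) ≤ n * (n - 1) := by
      have : 0 ≤ n * (n - 1) := by
        rcases le_or_gt n 0 with h | h
        · nlinarith
        · exact mul_nonneg h.le (by omega)
      exact_mod_cast this
    calc -(π * (n * (n - 1)) / 12 * (τ.im / normSq τ))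
        ≤ -(π * (n * (n - 1)) / 12 * 12) := by gcongr
      _ = -π * (n ^ 2 - n) := by ring
      _ ≤ -π * (1 * n ^ 2 - 2 * (1 / 2) * |(n : ℝ)|) := by
        have h := mul_le_mul_of_nonneg_left (le_abs_self (n : ℝ)) pi_pos.le
        linarith
      _ = _ := by push_cast; ring

lemma jtheta_three_mul_twelve_mul {τ : ℂ} (hτ : τ ≠ 0) :
    jtheta (3 * τ) (12 * τ) = I * cexp (-(3 * π * I / 4)) * cexp (-(3 * π * I * τ / 4)) *
      (cexp (π * I / (48 * τ)))⁻¹ / (-12 * I * τ) ^ (1 / 2 : ℂ) *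
      jacobiTheta₂ ((9 * τ + 1 / 2) / (12 * τ)) (-1 / (12 * τ)) := by
  have e : 3 * τ + 1 / 2 + 12 * τ / 2 = 9 * τ + 1 / 2 := by ring
  have e2 : -I * (12 * τ) = -12 * I * τ := by ring
  have e3 : cexp (π * I * (12 * τ) / 4) * cexp (π * I * (3 * τ)) *
      cexp (-π * I * (9 * τ + 1 / 2) ^ 2 / (12 * τ)) =
      cexp (-(3 * π * I / 4)) * cexp (-(3 * π * I * τ / 4)) * (cexp (π * I / (48 * τ)))⁻¹ := by
    rw [← Complex.exp_neg]
    simp only [← Complex.exp_add]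
    congr 1
    field_simp
    ring
  rw [jtheta_eq, jacobiTheta₂_functional_equation, e, e2]
  linear_combination (I / (-12 * I * τ) ^ (1 / 2 : ℂ) *
      jacobiTheta₂ ((9 * τ + 1 / 2) / (12 * τ)) (-1 / (12 * τ))) * e3

lemma appellMu_five_three_twelve (τ : ℂ) : appellMu (5 * τ) (3 * τ) (12 * τ) =
    cexp (5 * π * I * τ) / jtheta (3 * τ) (12 * τ) * ∑' n, appellTerm τ n := by
  rw [appellMu]
  congr 1
  · ring_nf
  · refine tsum_congr fun n ↦ ?_
    rw [appellTerm, qPow, qPow, mul_assoc, ← Complex.exp_add, ← Complex.exp_add]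
    ring_nf

lemma cexp_neg_three_pi_div_four_mul :
    cexp (-(3 * π * I / 4)) * (1 - I) = -(2 * (Real.sin (π / 4) : ℂ)) := by
  have h : cexp (-(3 * π * I / 4)) = -cexp ((π / 4 : ℝ) * I) := by
    rw [show -(3 * π * I / 4) = ((π / 4 : ℝ) : ℂ) * I - π * I by push_cast; ring,
      Complex.exp_sub, Complex.exp_pi_mul_I, div_neg, div_one]
  rw [h, Complex.exp_mul_I, ← ofReal_cos, ← ofReal_sin, Real.cos_pi_div_four,
    Real.sin_pi_div_four]
  linear_combination ((√2 / 2 : ℝ) : ℂ) * I_sq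

lemma tendsto_appellMu_div (M : ℝ) (hM : 0 < M) :
    Tendsto (fun τ ↦ appellMu (5 * τ) (3 * τ) (12 * τ) /
        (-(cexp (π * I / (48 * τ)) / (4 * I * ((Real.sin (π / 4) : ℝ) : ℂ) *
          ((Real.sin (5 * π / 12) : ℝ) : ℂ) * (-12 * I * τ) ^ ((1 : ℂ) / 2)))))
      (𝓝[upperCone M] 0) (𝓝 1) := by
  have hsin : Complex.sin (π * (5 / 12)) = ((Real.sin (5 * π / 12) : ℝ) : ℂ) := by
    push_cast; ring_nf
  have hs2 := sin_pi_mul_ne_zero five_div_twelve_mem_integerComplement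
  have hs1 : ((Real.sin (π / 4) : ℝ) : ℂ) ≠ 0 := by
    rw [Real.sin_pi_div_four]; norm_num
  have hS := tendsto_mul_tsum_appellTerm M
  rw [hsin] at hS hs2
  have hT := tendsto_jacobiTheta₂_inverted M hM
  have h1I : (1 - I : ℂ) ≠ 0 := fun h ↦ by simpa using congrArg Complex.re h
  set s1 := ((Real.sin (π / 4) : ℝ) : ℂ) with hs1def
  set s2 := ((Real.sin (5 * π / 12) : ℝ) : ℂ)
  have hE : Tendsto (fun τ ↦ cexp (23 * π * I * τ / 4)) (𝓝[upperCone M] 0) (𝓝 1) := by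
    have : Continuous fun τ ↦ cexp (23 * π * I * τ / 4) := by fun_prop
    simpa using (this.tendsto 0).mono_left nhdsWithin_le_nhds
  have hlim := (((hE.mul hS).const_mul (48 * I * s1 * s2)).div_const
    (cexp (-(3 * π * I / 4)))).div hT h1I
  have hval : 48 * I * s1 * s2 * (1 * (-1 / (24 * I * s2))) / cexp (-(3 * π * I / 4)) /
      (1 - I) = 1 := by
    rw [div_div, cexp_neg_three_pi_div_four_mul, ← hs1def]
    field_simp
    norm_num
  rw [hval] at hlim
  refine hlim.congr' ?_
  filter_upwards [nhdsWithin_upperCone_le M self_mem_nhdsWithin, hT.eventually_ne h1I]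
    with τ hτ hTne
  have hτ' : τ ≠ 0 := hτ
  have hR : ((-12 * I * τ) ^ ((1 : ℂ) / 2)) ^ 2 = -12 * I * τ := by
    simp
  have hRne : (-12 * I * τ) ^ ((1 : ℂ) / 2) ≠ 0 := by
    intro h
    rw [h] at hR
    simp [hτ'] at hR
  have hexp : cexp (23 * π * I * τ / 4) * cexp (-(3 * π * I * τ / 4)) = cexp (5 * π * I * τ) := by
    rw [← Complex.exp_add]
    ring_nf
  rw [appellMu_five_three_twelve, jtheta_three_mul_twelve_mul hτ', ← hexp]
  have n1 := Complex.exp_ne_zero (-(3 * π * I / 4))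
  have n2 := Complex.exp_ne_zero (-(3 * π * I * τ / 4))
  have n3 := Complex.exp_ne_zero (π * I / (48 * τ))
  simp only [Pi.div_apply]
  generalize cexp (-(3 * π * I / 4)) = a at *
  generalize cexp (-(3 * π * I * τ / 4)) = b at *
  generalize cexp (π * I / (48 * τ)) = c at *
  generalize (-12 * I * τ) ^ ((1 : ℂ) / 2) = R at *
  generalize jacobiTheta₂ ((9 * τ + 1 / 2) / (12 * τ)) (-1 / (12 * τ)) = T at *
  generalize ∑' n, appellTerm τ n = S at *
  have hI := I_ne_zero
  field_simp
  rw [hR]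
  ring

/-- As `τ → 0` in a cone,
`μ(5τ,3τ;12τ) ~ -e^{πi/(48τ)} / (4i sin(π/4) sin(5π/12) √(-12iτ))`. -/
theorem appellMu_near_zero_asymp (M : ℝ) (hM : 0 < M) :
    ∀ ε > (0 : ℝ), ∃ δ > (0 : ℝ), ∀ u v : ℝ, 0 < v → |u| ≤ M * v → v < δ →
      ‖appellMu (5 * ((u : ℂ) + (v : ℂ) * Complex.I)) (3 * ((u : ℂ) + (v : ℂ) * Complex.I))
          (12 * ((u : ℂ) + (v : ℂ) * Complex.I)) /
        (-(Complex.exp ((π : ℂ) * Complex.I / (48 * ((u : ℂ) + (v : ℂ) * Complex.I))) /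
          (4 * Complex.I * ((Real.sin (π / 4) : ℝ) : ℂ) * ((Real.sin (5 * π / 12) : ℝ) : ℂ) *
            (-12 * Complex.I * ((u : ℂ) + (v : ℂ) * Complex.I)) ^ ((1 : ℂ) / 2)))) - 1‖
        ≤ ε := by
  intro ε hε
  obtain ⟨δ, hδ, h⟩ := Metric.tendsto_nhdsWithin_nhds.mp (tendsto_appellMu_div M hM) ε hε
  refine ⟨δ / (1 + M), by positivity, fun u v hv hu hvδ ↦ ?_⟩
  have hmem : (u + v * I : ℂ) ∈ upperCone M := by simpa [upperCone] using ⟨hv, hu⟩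
  have hdist : dist (u + v * I : ℂ) 0 < δ := by
    rw [dist_zero_right]
    refine (norm_le_of_mem_upperCone hmem).trans_lt ?_
    rw [lt_div_iff₀ (by positivity)] at hvδ
    simpa [mul_comm] using hvδ
  have := h hmem hdist
  rw [dist_eq_norm] at this
  exact this.le
end
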